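/- arXiv:0903.4134 — 8 statements merged into one kernel-verified Lean document; each statement's English description precedes it below -/
import Mathlib

section
/- Let u : ℝ × ℝ → ℝ be smooth and spatially periodic, let λ₀ ∈ ℂ with λ₀ ≠ 0, and set m(t,x) = μ(u)(t) − u_xx(t,x). Suppose ψ : ℝ × ℝ → ℂ is smooth and satisfies, for all (t,x) ∈ ℝ × ℝ, the linear system ψ_xxx = −λ₀ m ψ and ψ_t = −(1/λ₀) ψ_xx − u ψ_x + u_x ψ. Then at every point (t,x) where ψ(t,x) ≠ 0, the μDP equation holds: μ(u_t)(t) − u_txx(t,x) + 3 μ(u)(t) u_x(t,x) − 3 u_x(t,x) u_xx(t,x) − u(t,x) u_xxx(t,x) = 0. -/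
open intervalIntegral

/-- Partial derivative in the second (spatial) variable. -/
noncomputable def pdx (u : ℝ × ℝ → ℝ) : ℝ × ℝ → ℝ := fun p => deriv (fun y => u (p.1, y)) p.2

/-- Partial derivative in the first (time) variable. -/
noncomputable def pdt (u : ℝ × ℝ → ℝ) : ℝ × ℝ → ℝ := fun p => deriv (fun s => u (s, p.2)) p.1

/-- Spatial partial derivative for complex-valued functions. -/
noncomputable def pdxC (ψ : ℝ × ℝ → ℂ) : ℝ × ℝ → ℂ := fun p => deriv (fun y => ψ (p.1, y)) p.2

/-- Time partial derivative for complex-valued functions. -/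
noncomputable def pdtC (ψ : ℝ × ℝ → ℂ) : ℝ × ℝ → ℂ := fun p => deriv (fun s => ψ (s, p.2)) p.1

/-- The spatial mean `μ(u)(t) = ∫₀¹ u(t,x) dx`. -/
noncomputable def muMean (u : ℝ × ℝ → ℝ) (t : ℝ) : ℝ := ∫ x in (0:ℝ)..1, u (t, x)

section PartialDerivatives

variable {E : Type*} [NormedAddCommGroup E] [NormedSpace ℝ E] {f : ℝ × ℝ → E}

/-- Partial derivative in the second variable of a vector-valued function. -/
noncomputable def partialSnd (f : ℝ × ℝ → E) : ℝ × ℝ → E :=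
  fun p => deriv (fun y => f (p.1, y)) p.2

/-- Partial derivative in the first variable of a vector-valued function. -/
noncomputable def partialFst (f : ℝ × ℝ → E) : ℝ × ℝ → E :=
  fun p => deriv (fun s => f (s, p.2)) p.1

theorem hasDerivAt_snd_fderiv (hf : Differentiable ℝ f) (t x : ℝ) :
    HasDerivAt (fun y => f (t, y)) (fderiv ℝ f (t, x) (0, 1)) x :=
  (hf (t, x)).hasFDerivAt.comp_hasDerivAt x ((hasDerivAt_const x t).prodMk (hasDerivAt_id x))

theorem hasDerivAt_fst_fderiv (hf : Differentiable ℝ f) (t x : ℝ) :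
    HasDerivAt (fun s => f (s, x)) (fderiv ℝ f (t, x) (1, 0)) t :=
  (hf (t, x)).hasFDerivAt.comp_hasDerivAt t ((hasDerivAt_id t).prodMk (hasDerivAt_const t x))

theorem partialSnd_eq_fderiv (hf : Differentiable ℝ f) :
    partialSnd f = fun p => fderiv ℝ f p (0, 1) :=
  funext fun p => (hasDerivAt_snd_fderiv hf p.1 p.2).deriv

theorem partialFst_eq_fderiv (hf : Differentiable ℝ f) :
    partialFst f = fun p => fderiv ℝ f p (1, 0) :=
  funext fun p => (hasDerivAt_fst_fderiv hf p.1 p.2).deriv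

theorem ContDiff.differentiable_of_top (hf : ContDiff ℝ (⊤ : ℕ∞) f) : Differentiable ℝ f :=
  hf.differentiable (by simp)

theorem ContDiff.hasDerivAt_partialSnd (hf : ContDiff ℝ (⊤ : ℕ∞) f) (t x : ℝ) :
    HasDerivAt (fun y => f (t, y)) (partialSnd f (t, x)) x :=
  (hasDerivAt_snd_fderiv hf.differentiable_of_top t x).differentiableAt.hasDerivAt

theorem ContDiff.hasDerivAt_partialFst (hf : ContDiff ℝ (⊤ : ℕ∞) f) (t x : ℝ) :
    HasDerivAt (fun s => f (s, x)) (partialFst f (t, x)) t :=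
  (hasDerivAt_fst_fderiv hf.differentiable_of_top t x).differentiableAt.hasDerivAt

theorem ContDiff.fderiv_top (hf : ContDiff ℝ (⊤ : ℕ∞) f) : ContDiff ℝ (⊤ : ℕ∞) (fderiv ℝ f) :=
  hf.fderiv_right (m := ((⊤ : ℕ∞) : WithTop ℕ∞)) (by simp)

theorem ContDiff.partialSnd (hf : ContDiff ℝ (⊤ : ℕ∞) f) :
    ContDiff ℝ (⊤ : ℕ∞) (partialSnd f) := by
  rw [partialSnd_eq_fderiv hf.differentiable_of_top]
  exact hf.fderiv_top.clm_apply contDiff_const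

theorem ContDiff.partialFst (hf : ContDiff ℝ (⊤ : ℕ∞) f) :
    ContDiff ℝ (⊤ : ℕ∞) (partialFst f) := by
  rw [partialFst_eq_fderiv hf.differentiable_of_top]
  exact hf.fderiv_top.clm_apply contDiff_const

theorem ContDiff.partialFst_partialSnd (hf : ContDiff ℝ (⊤ : ℕ∞) f) :
    _root_.partialFst (_root_.partialSnd f) = _root_.partialSnd (_root_.partialFst f) := by
  rw [partialFst_eq_fderiv hf.partialSnd.differentiable_of_top,
    partialSnd_eq_fderiv hf.partialFst.differentiable_of_top,
    partialFst_eq_fderiv hf.differentiable_of_top, partialSnd_eq_fderiv hf.differentiable_of_top]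
  funext p
  have hd : DifferentiableAt ℝ (fderiv ℝ f) p := hf.fderiv_top.differentiable_of_top p
  have hsymm : IsSymmSndFDerivAt ℝ f p :=
    hf.contDiffAt.isSymmSndFDerivAt (by simpa using WithTop.coe_le_coe.mpr (le_top : (2 : ℕ∞) ≤ ⊤))
  rw [fderiv_clm_apply hd (differentiableAt_const _),
    fderiv_clm_apply hd (differentiableAt_const _)]
  simpa using hsymm.eq (1, 0) (0, 1)

end PartialDerivatives

theorem hasDerivAt_muMean {u : ℝ × ℝ → ℝ} (hu : ContDiff ℝ (⊤ : ℕ∞) u) (t : ℝ) :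
    HasDerivAt (muMean u) (muMean (pdt u) t) t := by
  have hcont : Continuous (pdt u) := ContDiff.continuous (ContDiff.partialFst hu)
  obtain ⟨C, hC⟩ := ((isCompact_closedBall t 1).prod
    (isCompact_uIcc (a := (0 : ℝ)) (b := 1))).exists_bound_of_continuousOn hcont.continuousOn
  refine (intervalIntegral.hasDerivAt_integral_of_dominated_loc_of_deriv_le
    (F := fun s x => u (s, x)) (F' := fun s x => pdt u (s, x)) (bound := fun _ => C)
    (Metric.closedBall_mem_nhds t one_pos) (Filter.Eventually.of_forall fun s => ?_) ?_ ?_ ?_ ?_ ?_).2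
  · exact (hu.continuous.comp (by fun_prop : Continuous fun x : ℝ => (s, x))).aestronglyMeasurable
  · exact (hu.continuous.comp (by fun_prop : Continuous fun x : ℝ => (t, x))).intervalIntegrable _ _
  · exact (hcont.comp (by fun_prop : Continuous fun x : ℝ => (t, x))).aestronglyMeasurable
  · exact Filter.Eventually.of_forall fun x hx s hs => hC (s, x) ⟨hs, Set.uIoc_subset_uIcc hx⟩
  · exact intervalIntegrable_const
  · exact Filter.Eventually.of_forall fun x _ s _ => hu.hasDerivAt_partialFst s x

/-- the compatibility of the Lax pair forces the μDP equation
wherever the eigenfunction ψ is nonzero. -/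
theorem muDP_lax_pair
    (u : ℝ × ℝ → ℝ) (hu : ContDiff ℝ (⊤ : ℕ∞) u)
    (hper : ∀ t x, u (t, x + 1) = u (t, x))
    (lam : ℂ) (hlam : lam ≠ 0)
    (m : ℝ × ℝ → ℝ)
    (hm : ∀ t x, m (t, x) = muMean u t - pdx (pdx u) (t, x))
    (ψ : ℝ × ℝ → ℂ) (hψ : ContDiff ℝ (⊤ : ℕ∞) ψ)
    (hLax1 : ∀ t x : ℝ, pdxC (pdxC (pdxC ψ)) (t, x) = -(lam * (m (t, x) : ℂ) * ψ (t, x)))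
    (hLax2 : ∀ t x : ℝ, pdtC ψ (t, x) =
      -(1 / lam) * pdxC (pdxC ψ) (t, x) - (u (t, x) : ℂ) * pdxC ψ (t, x)
        + (pdx u (t, x) : ℂ) * ψ (t, x)) :
    ∀ t x : ℝ, ψ (t, x) ≠ 0 →
      muMean (pdt u) t - pdx (pdx (pdt u)) (t, x) + 3 * muMean u t * pdx u (t, x)
        - 3 * pdx u (t, x) * pdx (pdx u) (t, x) - u (t, x) * pdx (pdx (pdx u)) (t, x) = 0 := by
  intro t x hψ0
  have hux := hu.partialSnd
  have huxx := hux.partialSnd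
  have hU0 (t x : ℝ) : HasDerivAt (fun y => (u (t, y) : ℂ)) (pdx u (t, x)) x :=
    (hu.hasDerivAt_partialSnd t x).ofReal_comp
  have hU1 (t x : ℝ) : HasDerivAt (fun y => (pdx u (t, y) : ℂ)) (pdx (pdx u) (t, x)) x :=
    (hux.hasDerivAt_partialSnd t x).ofReal_comp
  have hU2 (t x : ℝ) :
      HasDerivAt (fun y => (pdx (pdx u) (t, y) : ℂ)) (pdx (pdx (pdx u)) (t, x)) x :=
    (huxx.hasDerivAt_partialSnd t x).ofReal_comp
  have hP0 (t x : ℝ) : HasDerivAt (fun y => ψ (t, y)) (pdxC ψ (t, x)) x :=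
    hψ.hasDerivAt_partialSnd t x
  have hP1 (t x : ℝ) : HasDerivAt (fun y => pdxC ψ (t, y)) (pdxC (pdxC ψ) (t, x)) x :=
    hψ.partialSnd.hasDerivAt_partialSnd t x
  have hP2 (t x : ℝ) :
      HasDerivAt (fun y => pdxC (pdxC ψ) (t, y)) (-(lam * (m (t, x) : ℂ) * ψ (t, x))) x := by
    rw [← hLax1]
    exact hψ.partialSnd.partialSnd.hasDerivAt_partialSnd t x
  have hmx (t x : ℝ) :
      HasDerivAt (fun y => (m (t, y) : ℂ)) (-(pdx (pdx (pdx u)) (t, x) : ℂ)) x := by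
    have h : HasDerivAt (fun y => m (t, y)) (-(pdx (pdx (pdx u)) (t, x))) x := by
      simp only [hm]
      exact (huxx.hasDerivAt_partialSnd t x).const_sub _
    simpa using h.ofReal_comp
  have hmt : HasDerivAt (fun s => (m (s, x) : ℂ))
      ((muMean (pdt u) t - pdx (pdx (pdt u)) (t, x) : ℝ) : ℂ) t := by
    have hcomm : pdt (pdx (pdx u)) = pdx (pdx (pdt u)) :=
      hux.partialFst_partialSnd.trans (congrArg pdx hu.partialFst_partialSnd)
    refine HasDerivAt.ofReal_comp (f := fun s => m (s, x)) ?_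
    simp only [hm]
    rw [← hcomm]
    exact (hasDerivAt_muMean hu t).sub (huxx.hasDerivAt_partialFst t x)
  have hψt : HasDerivAt (fun s => ψ (s, x)) (pdtC ψ (t, x)) t := hψ.hasDerivAt_partialFst t x
  have hcommC : pdtC (pdxC (pdxC (pdxC ψ))) = pdxC (pdxC (pdxC (pdtC ψ))) :=
    hψ.partialSnd.partialSnd.partialFst_partialSnd.trans
      ((congrArg pdxC hψ.partialSnd.partialFst_partialSnd).trans
        (congrArg (fun f => pdxC (pdxC f)) hψ.partialFst_partialSnd))
  have hR1 (t x : ℝ) : pdxC (pdtC ψ) (t, x) =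
      m (t, x) * ψ (t, x) - u (t, x) * pdxC (pdxC ψ) (t, x)
        + pdx (pdx u) (t, x) * ψ (t, x) := by
    refine HasDerivAt.deriv (f := fun y => pdtC ψ (t, y)) ?_
    simp only [hLax2]
    refine ((((hP2 t x).const_mul (-(1 / lam))).sub ((hU0 t x).mul (hP1 t x))).add
      ((hU1 t x).mul (hP0 t x))).congr_deriv ?_
    field_simp
    ring
  have hR2 (t x : ℝ) : pdxC (pdxC (pdtC ψ)) (t, x) =
      m (t, x) * pdxC ψ (t, x) - pdx u (t, x) * pdxC (pdxC ψ) (t, x)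
        + lam * (u (t, x) * (m (t, x) * ψ (t, x))) + pdx (pdx u) (t, x) * pdxC ψ (t, x) := by
    refine HasDerivAt.deriv (f := fun y => pdxC (pdtC ψ) (t, y)) ?_
    simp only [hR1]
    refine ((((hmx t x).mul (hP0 t x)).sub ((hU0 t x).mul (hP2 t x))).add
      ((hU2 t x).mul (hP0 t x))).congr_deriv ?_
    ring
  have hR3 : pdxC (pdxC (pdxC (pdtC ψ))) (t, x) =
      m (t, x) * pdxC (pdxC ψ) (t, x) + 2 * lam * pdx u (t, x) * m (t, x) * ψ (t, x)
        - lam * u (t, x) * pdx (pdx (pdx u)) (t, x) * ψ (t, x)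
        + lam * u (t, x) * m (t, x) * pdxC ψ (t, x) := by
    refine HasDerivAt.deriv (f := fun y => pdxC (pdxC (pdtC ψ)) (t, y)) ?_
    simp only [hR2]
    refine (((((hmx t x).mul (hP1 t x)).sub ((hU1 t x).mul (hP2 t x))).add
      (((hU0 t x).mul ((hmx t x).mul (hP0 t x))).const_mul lam)).add
      ((hU2 t x).mul (hP1 t x))).congr_deriv ?_
    simp only [Pi.mul_apply]
    ring
  have hL : pdtC (pdxC (pdxC (pdxC ψ))) (t, x) =
      -(lam * (((muMean (pdt u) t - pdx (pdx (pdt u)) (t, x) : ℝ) : ℂ) * ψ (t, x)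
        + m (t, x) * pdtC ψ (t, x))) := by
    refine HasDerivAt.deriv (f := fun s => pdxC (pdxC (pdxC ψ)) (s, x)) ?_
    simp only [hLax1, mul_assoc]
    exact ((hmt.mul hψt).const_mul lam).neg
  rw [hcommC, hR3, hLax2] at hL
  have hzero : lam * ψ (t, x) *
      (((muMean (pdt u) t - pdx (pdx (pdt u)) (t, x) : ℝ) : ℂ)
        + 3 * pdx u (t, x) * m (t, x) - u (t, x) * pdx (pdx (pdx u)) (t, x)) = 0 := by
    field_simp at hL
    linear_combination hL
  have hfactor := (mul_eq_zero.mp hzero).resolve_left (mul_ne_zero hlam hψ0)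
  have hreal : muMean (pdt u) t - pdx (pdx (pdt u)) (t, x)
      + 3 * pdx u (t, x) * m (t, x) - u (t, x) * pdx (pdx (pdx u)) (t, x) = 0 := by
    exact_mod_cast hfactor
  rw [hm] at hreal
  linear_combination hreal
end

section
/- Let u : ℝ × ℝ → ℝ be smooth, let λ₀ ∈ ℂ with λ₀ ≠ 0, and set m(t,x) = −u_xx(t,x). Suppose ψ : ℝ × ℝ → ℂ is smooth and satisfies, for all (t,x) ∈ ℝ × ℝ, the linear system ψ_xxx = −λ₀ m ψ and ψ_t = −(1/λ₀) ψ_xx − u ψ_x + u_x ψ. Then at every point (t,x) where ψ(t,x) ≠ 0, the μBurgers equation holds: u_txx(t,x) + 3 u_x(t,x) u_xx(t,x) + u(t,x) u_xxx(t,x) = 0. -/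
open intervalIntegral

section DirectionalDerivative

variable {E : Type*} [NormedAddCommGroup E] [NormedSpace ℝ E] {f : ℝ × ℝ → E}

theorem ContDiff.hasDerivAt_snd_slice (hf : ContDiff ℝ (⊤ : ℕ∞) f) (t x : ℝ) :
    HasDerivAt (fun y => f (t, y)) (fderiv ℝ f (t, x) (0, 1)) x :=
  ((hf.differentiable (by simp)) (t, x)).hasFDerivAt.comp_hasDerivAt x
    ((hasDerivAt_const x t).prodMk (hasDerivAt_id x))

theorem ContDiff.hasDerivAt_fst_slice (hf : ContDiff ℝ (⊤ : ℕ∞) f) (t x : ℝ) :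
    HasDerivAt (fun s => f (s, x)) (fderiv ℝ f (t, x) (1, 0)) t :=
  ((hf.differentiable (by simp)) (t, x)).hasFDerivAt.comp_hasDerivAt t
    ((hasDerivAt_id t).prodMk (hasDerivAt_const t x))

theorem ContDiff.contDiff_fderiv_const_apply (hf : ContDiff ℝ (⊤ : ℕ∞) f) (v : ℝ × ℝ) :
    ContDiff ℝ (⊤ : ℕ∞) (fun p => fderiv ℝ f p v) :=
  (hf.fderiv_right (by simp)).clm_apply contDiff_const

theorem ContDiff.fderiv_fderiv_apply_comm (hf : ContDiff ℝ (⊤ : ℕ∞) f) (v w p : ℝ × ℝ) :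
    fderiv ℝ (fun q => fderiv ℝ f q v) p w = fderiv ℝ (fun q => fderiv ℝ f q w) p v := by
  have hd : DifferentiableAt ℝ (fderiv ℝ f) p :=
    (hf.fderiv_right (m := (⊤ : ℕ∞)) (by simp)).differentiable (by simp) p
  have hsymm : IsSymmSndFDerivAt ℝ f p := by
    refine hf.contDiffAt.isSymmSndFDerivAt ?_
    simp only [minSmoothness_of_isRCLikeNormedField]
    exact WithTop.coe_le_coe.2 le_top
  rw [fderiv_clm_apply hd (differentiableAt_const v), fderiv_clm_apply hd (differentiableAt_const w)]
  simpa using hsymm w v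

end DirectionalDerivative

theorem pdx_eq_fderiv {f : ℝ × ℝ → ℝ} (hf : ContDiff ℝ (⊤ : ℕ∞) f) :
    pdx f = fun p => fderiv ℝ f p (0, 1) :=
  funext fun p => (hf.hasDerivAt_snd_slice p.1 p.2).deriv

theorem ContDiff.pdx {f : ℝ × ℝ → ℝ} (hf : ContDiff ℝ (⊤ : ℕ∞) f) :
    ContDiff ℝ (⊤ : ℕ∞) (_root_.pdx f) := by
  rw [pdx_eq_fderiv hf]
  exact hf.contDiff_fderiv_const_apply _

theorem ContDiff.hasDerivAt_pdx {f : ℝ × ℝ → ℝ} (hf : ContDiff ℝ (⊤ : ℕ∞) f) (t x : ℝ) :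
    HasDerivAt (fun y => f (t, y)) (_root_.pdx f (t, x)) x := by
  rw [pdx_eq_fderiv hf]
  exact hf.hasDerivAt_snd_slice t x

theorem pdt_eq_fderiv {f : ℝ × ℝ → ℝ} (hf : ContDiff ℝ (⊤ : ℕ∞) f) :
    pdt f = fun p => fderiv ℝ f p (1, 0) :=
  funext fun p => (hf.hasDerivAt_fst_slice p.1 p.2).deriv

theorem ContDiff.pdt {f : ℝ × ℝ → ℝ} (hf : ContDiff ℝ (⊤ : ℕ∞) f) :
    ContDiff ℝ (⊤ : ℕ∞) (_root_.pdt f) := by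
  rw [pdt_eq_fderiv hf]
  exact hf.contDiff_fderiv_const_apply _

theorem ContDiff.hasDerivAt_pdt {f : ℝ × ℝ → ℝ} (hf : ContDiff ℝ (⊤ : ℕ∞) f) (t x : ℝ) :
    HasDerivAt (fun y => f (y, x)) (_root_.pdt f (t, x)) t := by
  rw [pdt_eq_fderiv hf]
  exact hf.hasDerivAt_fst_slice t x

theorem pdxC_eq_fderiv {f : ℝ × ℝ → ℂ} (hf : ContDiff ℝ (⊤ : ℕ∞) f) :
    pdxC f = fun p => fderiv ℝ f p (0, 1) :=
  funext fun p => (hf.hasDerivAt_snd_slice p.1 p.2).deriv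

theorem ContDiff.pdxC {f : ℝ × ℝ → ℂ} (hf : ContDiff ℝ (⊤ : ℕ∞) f) :
    ContDiff ℝ (⊤ : ℕ∞) (_root_.pdxC f) := by
  rw [pdxC_eq_fderiv hf]
  exact hf.contDiff_fderiv_const_apply _

theorem ContDiff.hasDerivAt_pdxC {f : ℝ × ℝ → ℂ} (hf : ContDiff ℝ (⊤ : ℕ∞) f) (t x : ℝ) :
    HasDerivAt (fun y => f (t, y)) (_root_.pdxC f (t, x)) x := by
  rw [pdxC_eq_fderiv hf]
  exact hf.hasDerivAt_snd_slice t x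

theorem pdtC_eq_fderiv {f : ℝ × ℝ → ℂ} (hf : ContDiff ℝ (⊤ : ℕ∞) f) :
    pdtC f = fun p => fderiv ℝ f p (1, 0) :=
  funext fun p => (hf.hasDerivAt_fst_slice p.1 p.2).deriv

theorem ContDiff.pdtC {f : ℝ × ℝ → ℂ} (hf : ContDiff ℝ (⊤ : ℕ∞) f) :
    ContDiff ℝ (⊤ : ℕ∞) (_root_.pdtC f) := by
  rw [pdtC_eq_fderiv hf]
  exact hf.contDiff_fderiv_const_apply _

theorem ContDiff.hasDerivAt_pdtC {f : ℝ × ℝ → ℂ} (hf : ContDiff ℝ (⊤ : ℕ∞) f) (t x : ℝ) :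
    HasDerivAt (fun y => f (y, x)) (_root_.pdtC f (t, x)) t := by
  rw [pdtC_eq_fderiv hf]
  exact hf.hasDerivAt_fst_slice t x

theorem pdt_pdx_comm {f : ℝ × ℝ → ℝ} (hf : ContDiff ℝ (⊤ : ℕ∞) f) :
    pdt (pdx f) = pdx (pdt f) := by
  rw [pdt_eq_fderiv hf.pdx, pdx_eq_fderiv hf.pdt, pdx_eq_fderiv hf, pdt_eq_fderiv hf]
  exact funext fun p => hf.fderiv_fderiv_apply_comm _ _ p

theorem pdtC_pdxC_comm {f : ℝ × ℝ → ℂ} (hf : ContDiff ℝ (⊤ : ℕ∞) f) :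
    pdtC (pdxC f) = pdxC (pdtC f) := by
  rw [pdtC_eq_fderiv hf.pdxC, pdxC_eq_fderiv hf.pdtC, pdxC_eq_fderiv hf, pdtC_eq_fderiv hf]
  exact funext fun p => hf.fderiv_fderiv_apply_comm _ _ p

/-- the compatibility of the Lax pair with `m = -u_xx` forces the
μBurgers equation wherever the eigenfunction ψ is nonzero. -/
theorem muBurgers_lax_pair
    (u : ℝ × ℝ → ℝ) (hu : ContDiff ℝ (⊤ : ℕ∞) u)
    (lam : ℂ) (hlam : lam ≠ 0)
    (m : ℝ × ℝ → ℝ)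
    (hm : ∀ t x, m (t, x) = -pdx (pdx u) (t, x))
    (ψ : ℝ × ℝ → ℂ) (hψ : ContDiff ℝ (⊤ : ℕ∞) ψ)
    (hLax1 : ∀ t x : ℝ, pdxC (pdxC (pdxC ψ)) (t, x) = -(lam * (m (t, x) : ℂ) * ψ (t, x)))
    (hLax2 : ∀ t x : ℝ, pdtC ψ (t, x) =
      -(1 / lam) * pdxC (pdxC ψ) (t, x) - (u (t, x) : ℂ) * pdxC ψ (t, x)
        + (pdx u (t, x) : ℂ) * ψ (t, x)) :
    ∀ t x : ℝ, ψ (t, x) ≠ 0 →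
      pdx (pdx (pdt u)) (t, x) + 3 * pdx u (t, x) * pdx (pdx u) (t, x)
        + u (t, x) * pdx (pdx (pdx u)) (t, x) = 0 := by
  have hux := hu.pdx
  have huxx := hux.pdx
  have hψx := hψ.pdxC
  have hψxx := hψx.pdxC
  have hψxxx : ∀ t x : ℝ, pdxC (pdxC (pdxC ψ)) (t, x) =
      lam * (pdx (pdx u) (t, x) : ℂ) * ψ (t, x) := by
    intro t x
    rw [hLax1, hm]
    push_cast
    ring
  have hψtx : ∀ t x : ℝ, pdxC (pdtC ψ) (t, x) = -((u (t, x) : ℂ) * pdxC (pdxC ψ) (t, x)) := by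
    intro t x
    have h := ((((hψxx.hasDerivAt_pdxC t x).const_mul (-(1 / lam))).sub
      ((hu.hasDerivAt_pdx t x).ofReal_comp.mul (hψx.hasDerivAt_pdxC t x))).add
      ((hux.hasDerivAt_pdx t x).ofReal_comp.mul (hψ.hasDerivAt_pdxC t x)))
    refine ((h.congr_of_eventuallyEq (.of_forall fun y => hLax2 t y)).deriv).trans ?_
    rw [hψxxx]
    field_simp
    ring
  have hψtxx : ∀ t x : ℝ, pdxC (pdxC (pdtC ψ)) (t, x) =
      -((pdx u (t, x) : ℂ) * pdxC (pdxC ψ) (t, x)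
        + (u (t, x) : ℂ) * (lam * (pdx (pdx u) (t, x) : ℂ) * ψ (t, x))) := by
    intro t x
    have h := ((hu.hasDerivAt_pdx t x).ofReal_comp.mul (hψxx.hasDerivAt_pdxC t x)).neg
    rw [hψxxx] at h
    exact (h.congr_of_eventuallyEq (.of_forall fun y => hψtx t y)).deriv
  intro t x hne
  have hψtxxx := ((((hux.hasDerivAt_pdx t x).ofReal_comp.mul (hψxx.hasDerivAt_pdxC t x)).add
    ((hu.hasDerivAt_pdx t x).ofReal_comp.mul
      (((huxx.hasDerivAt_pdx t x).ofReal_comp.const_mul lam).mul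
        (hψ.hasDerivAt_pdxC t x)))).neg.congr_of_eventuallyEq
      (.of_forall fun y => hψtxx t y)).deriv
  have hψxxxt := ((((huxx.hasDerivAt_pdt t x).ofReal_comp.const_mul lam).mul
    (hψ.hasDerivAt_pdtC t x)).congr_of_eventuallyEq
      (.of_forall fun s => hψxxx s x)).deriv
  have hcomm : pdtC (pdxC (pdxC (pdxC ψ))) (t, x) = pdxC (pdxC (pdxC (pdtC ψ))) (t, x) := by
    rw [pdtC_pdxC_comm hψxx, pdtC_pdxC_comm hψx, pdtC_pdxC_comm hψ]
  have hcompat := hψxxxt.symm.trans (hcomm.trans hψtxxx)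
  rw [hLax2, hψxxx, pdt_pdx_comm hux, pdt_pdx_comm hu] at hcompat
  have hfactor : lam * ψ (t, x) * ((pdx (pdx (pdt u)) (t, x)
      + 3 * pdx u (t, x) * pdx (pdx u) (t, x)
      + u (t, x) * pdx (pdx (pdx u)) (t, x) : ℝ) : ℂ) = 0 := by
    push_cast
    simp only [Pi.mul_apply] at hcompat
    field_simp at hcompat
    linear_combination hcompat
  exact_mod_cast (mul_eq_zero.1 hfactor).resolve_left (mul_ne_zero hlam hne)
end

section
/- Let λ ∈ ℝ with λ ≠ 0, and let m₁, m₂ : ℝ → ℝ be smooth 1-periodic functions with m₁(x) ≠ 0 and m₂(x) ≠ 0 for all x (so each mᵢ has a constant sign sgn(mᵢ) ∈ {+1, −1}). Then the following are equivalent: (i) there exists a smooth ξ : ℝ → ℝ with ξ'(x) > 0 for all x and ξ(x+1) = ξ(x) + 1 such that m₂(x) = m₁(ξ(x)) · (ξ'(x))^λ for all x; (ii) sgn(m₁) · (∫₀¹ |m₁(x)|^(1/λ) dx)^λ = sgn(m₂) · (∫₀¹ |m₂(x)|^(1/λ) dx)^λ. In particular, every nowhere-vanishing smooth 1-periodic m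 lies in the orbit of the constant density a = sgn(m)·(∫₀¹ |m|^(1/λ) dx)^λ under the action m ↦ (m∘ξ)·(ξ')^λ. -/
open intervalIntegral

/-- Lifts to the line of the smooth orientation-preserving diffeomorphisms of the circle. -/
def IsCircleDiffeoLift (ξ : ℝ → ℝ) : Prop :=
  ContDiff ℝ (⊤ : ℕ∞) ξ ∧ (∀ x, 0 < deriv ξ x) ∧ ∀ x, ξ (x + 1) = ξ x + 1

namespace IsCircleDiffeoLift

variable {ξ η : ℝ → ℝ}

lemma differentiable (h : IsCircleDiffeoLift ξ) : Differentiable ℝ ξ :=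
  h.1.differentiable (by simp)

lemma surjective (h : IsCircleDiffeoLift ξ) : Function.Surjective ξ := by
  intro y
  have key : ∀ n : ℤ, ξ n = ξ 0 + n := by
    intro n
    induction n using Int.induction_on with
    | zero => simp
    | succ n ih =>
      push_cast at ih ⊢
      rw [h.2.2, ih]
      ring
    | pred n ih =>
      have := h.2.2 (-(n : ℝ) - 1)
      push_cast at ih ⊢
      rw [sub_add_cancel, ih] at this
      linarith
  have h1 := key ⌊y - ξ 0⌋
  have h2 := h.2.2 ⌊y - ξ 0⌋
  have h3 := Int.floor_le (y - ξ 0)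
  have h4 := Int.lt_floor_add_one (y - ξ 0)
  obtain ⟨x, -, hx⟩ := intermediate_value_Icc
    (a := (⌊y - ξ 0⌋ : ℝ)) (b := ⌊y - ξ 0⌋ + 1) (by linarith) h.1.continuous.continuousOn
    (show y ∈ Set.Icc _ _ from ⟨by linarith, by linarith⟩)
  exact ⟨x, hx⟩

lemma comp (hξ : IsCircleDiffeoLift ξ) (hη : IsCircleDiffeoLift η) :
    IsCircleDiffeoLift (ξ ∘ η) := by
  refine ⟨hξ.1.comp hη.1, fun x => ?_, fun x => ?_⟩
  · rw [deriv_comp x (hξ.differentiable _) (hη.differentiable _)]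
    exact mul_pos (hξ.2.1 _) (hη.2.1 _)
  · simp [hη.2.2, hξ.2.2]

lemma exists_rightInverse (h : IsCircleDiffeoLift ξ) :
    ∃ η, IsCircleDiffeoLift η ∧ ∀ x, ξ (η x) = x := by
  have hmono : StrictMono ξ := strictMono_of_deriv_pos h.2.1
  let e : ℝ ≃ₜ ℝ := (hmono.orderIsoOfSurjective ξ h.surjective).toHomeomorph
  have he : ∀ x, ξ (e.symm x) = x := e.apply_symm_apply
  have hsmooth : ContDiff ℝ (⊤ : ℕ∞) e.symm :=
    e.contDiff_symm_deriv (fun x => (h.2.1 x).ne') (fun x => (h.differentiable x).hasDerivAt) h.1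
  refine ⟨e.symm, ⟨hsmooth, fun x => ?_, fun x => ?_⟩, he⟩
  · have hd := deriv_comp x (h.differentiable (e.symm x)) (hsmooth.differentiable (by simp) x)
    rw [show ξ ∘ e.symm = id from funext he, deriv_id] at hd
    exact pos_of_mul_pos_right (hd ▸ one_pos) (h.2.1 _).le
  · apply hmono.injective
    rw [h.2.2, he, he]

end IsCircleDiffeoLift

lemma exists_isCircleDiffeoLift_deriv_eq {ρ : ℝ → ℝ} (hρ : ContDiff ℝ (⊤ : ℕ∞) ρ)
    (hpos : ∀ x, 0 < ρ x) (hper : ∀ x, ρ (x + 1) = ρ x) :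
    ∃ ξ, IsCircleDiffeoLift ξ ∧ ∀ x, deriv ξ x = ρ x / ∫ y in (0 : ℝ)..1, ρ y := by
  have hint : ∀ a b, IntervalIntegrable ρ MeasureTheory.volume a b :=
    fun a b => hρ.continuous.intervalIntegrable a b
  have hI : 0 < ∫ y in (0 : ℝ)..1, ρ y :=
    intervalIntegral_pos_of_pos (hint 0 1) hpos one_pos
  have hd : ∀ x, HasDerivAt (fun x => (∫ y in (0 : ℝ)..x, ρ y) / ∫ y in (0 : ℝ)..1, ρ y)
      (ρ x / ∫ y in (0 : ℝ)..1, ρ y) x := fun x =>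
    (integral_hasDerivAt_right (hint 0 x) (hρ.continuous.stronglyMeasurableAtFilter _ _)
      hρ.continuous.continuousAt).div_const _
  refine ⟨_, ⟨?_, fun x => ?_, fun x => ?_⟩, fun x => (hd x).deriv⟩
  · refine contDiff_infty_iff_deriv.2 ⟨fun x => (hd x).differentiableAt, ?_⟩
    rw [funext fun x => (hd x).deriv]
    exact hρ.div_const _
  · rw [(hd x).deriv]
    exact div_pos (hpos x) hI
  · have hper' : Function.Periodic ρ 1 := hper
    have := hper'.intervalIntegral_add_eq x 0
    rw [zero_add] at this
    rw [← integral_add_adjacent_intervals (hint 0 x) (hint x (x + 1)), this, add_div,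
      div_self hI.ne']

lemma Real.sign_eq_of_continuous_of_ne_zero {m : ℝ → ℝ} (hm : Continuous m)
    (h0 : ∀ x, m x ≠ 0) (x y : ℝ) : Real.sign (m x) = Real.sign (m y) := by
  have hmem : ¬ ∃ z, m z = 0 := fun ⟨z, hz⟩ => h0 z hz
  rcases (h0 x).lt_or_gt with hx | hx <;> rcases (h0 y).lt_or_gt with hy | hy
  · rw [sign_of_neg hx, sign_of_neg hy]
  · exact absurd (mem_range_of_exists_le_of_exists_ge hm ⟨x, hx.le⟩ ⟨y, hy.le⟩) hmem
  · exact absurd (mem_range_of_exists_le_of_exists_ge hm ⟨y, hy.le⟩ ⟨x, hx.le⟩) hmem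
  · rw [sign_of_pos hx, sign_of_pos hy]

lemma contDiff_abs_rpow_of_ne_zero {m : ℝ → ℝ} (hm : ContDiff ℝ (⊤ : ℕ∞) m)
    (h0 : ∀ x, m x ≠ 0) (p : ℝ) : ContDiff ℝ (⊤ : ℕ∞) fun x => |m x| ^ p :=
  (contDiff_iff_contDiffAt.2 fun x => hm.contDiffAt.abs (h0 x)).rpow_const_of_ne
    fun x => abs_ne_zero.2 (h0 x)

lemma exists_isCircleDiffeoLift_eq_const_mul {lam : ℝ} (hlam : lam ≠ 0) {m : ℝ → ℝ}
    (hm : ContDiff ℝ (⊤ : ℕ∞) m) (hper : ∀ x, m (x + 1) = m x) (h0 : ∀ x, m x ≠ 0) :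
    ∃ ξ, IsCircleDiffeoLift ξ ∧ ∀ x, m x =
      (Real.sign (m 0) * (∫ y in (0 : ℝ)..1, |m y| ^ (1 / lam)) ^ lam) * (deriv ξ x) ^ lam := by
  have hρ := contDiff_abs_rpow_of_ne_zero hm h0 (1 / lam)
  have hpos : ∀ x, 0 < |m x| ^ (1 / lam) := fun x => Real.rpow_pos_of_pos (abs_pos.2 (h0 x)) _
  obtain ⟨ξ, hξ, hd⟩ := exists_isCircleDiffeoLift_deriv_eq hρ hpos fun x => by rw [hper]
  have hI : 0 < ∫ y in (0 : ℝ)..1, |m y| ^ (1 / lam) :=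
    intervalIntegral_pos_of_pos (hρ.continuous.intervalIntegrable 0 1) hpos one_pos
  refine ⟨ξ, hξ, fun x => ?_⟩
  rw [mul_assoc, ← Real.mul_rpow hI.le (hξ.2.1 x).le, hd, mul_div_cancel₀ _ hI.ne',
    ← Real.rpow_mul (abs_nonneg _), one_div_mul_cancel hlam, Real.rpow_one,
    Real.sign_eq_of_continuous_of_ne_zero hm.continuous h0 0 x]
  rcases (h0 x).lt_or_gt with hx | hx
  · rw [Real.sign_of_neg hx, abs_of_neg hx, neg_one_mul, neg_neg]
  · rw [Real.sign_of_pos hx, abs_of_pos hx, one_mul]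

lemma IsCircleDiffeoLift.integral_abs_rpow_eq {lam : ℝ} (hlam : lam ≠ 0) {m ξ : ℝ → ℝ}
    (hm : ContDiff ℝ (⊤ : ℕ∞) m) (hper : ∀ x, m (x + 1) = m x) (h0 : ∀ x, m x ≠ 0)
    (hξ : IsCircleDiffeoLift ξ) :
    ∫ x in (0 : ℝ)..1, |m (ξ x) * (deriv ξ x) ^ lam| ^ (1 / lam)
      = ∫ x in (0 : ℝ)..1, |m x| ^ (1 / lam) := by
  have hρ := contDiff_abs_rpow_of_ne_zero hm h0 (1 / lam)
  have hpt : ∀ x, |m (ξ x) * (deriv ξ x) ^ lam| ^ (1 / lam)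
      = ((fun y => |m y| ^ (1 / lam)) ∘ ξ) x * deriv ξ x := by
    intro x
    have hp := Real.rpow_pos_of_pos (hξ.2.1 x) lam
    rw [abs_mul, abs_of_pos hp, Real.mul_rpow (abs_nonneg _) hp.le,
      ← Real.rpow_mul (hξ.2.1 x).le, mul_one_div_cancel hlam, Real.rpow_one]
    rfl
  have hper' : Function.Periodic (fun y => |m y| ^ (1 / lam)) 1 := fun x => by
    simp only [hper]
  have h1 : ξ 1 = ξ 0 + 1 := by simpa using hξ.2.2 0
  simp_rw [hpt]
  rw [integral_comp_mul_deriv (fun x _ => (hξ.differentiable x).hasDerivAt)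
    (hξ.1.continuous_deriv (by simp)).continuousOn hρ.continuous, h1,
    hper'.intervalIntegral_add_eq (ξ 0) 0, zero_add]

/-- classification of the orbits of the diffeomorphism group of the circle
on nowhere-vanishing tensor densities of weight λ: two densities are in the same orbit
iff they have the same value of `sgn(m)·(∫₀¹ |m|^(1/λ))^λ`; in particular every such
density is in the orbit of a constant one. -/
theorem density_orbit_classification
    (lam : ℝ) (hlam : lam ≠ 0)
    (m₁ m₂ : ℝ → ℝ) (hm₁ : ContDiff ℝ (⊤ : ℕ∞) m₁) (hm₂ : ContDiff ℝ (⊤ : ℕ∞) m₂)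
    (hm₁per : ∀ x, m₁ (x + 1) = m₁ x) (hm₂per : ∀ x, m₂ (x + 1) = m₂ x)
    (hm₁0 : ∀ x, m₁ x ≠ 0) (hm₂0 : ∀ x, m₂ x ≠ 0) :
    ((∃ ξ : ℝ → ℝ, ContDiff ℝ (⊤ : ℕ∞) ξ ∧ (∀ x, 0 < deriv ξ x) ∧ (∀ x, ξ (x + 1) = ξ x + 1) ∧
        ∀ x, m₂ x = m₁ (ξ x) * (deriv ξ x) ^ lam)
      ↔ Real.sign (m₁ 0) * (∫ x in (0:ℝ)..1, |m₁ x| ^ (1 / lam)) ^ lam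
          = Real.sign (m₂ 0) * (∫ x in (0:ℝ)..1, |m₂ x| ^ (1 / lam)) ^ lam)
    ∧ (∃ ξ : ℝ → ℝ, ContDiff ℝ (⊤ : ℕ∞) ξ ∧ (∀ x, 0 < deriv ξ x) ∧ (∀ x, ξ (x + 1) = ξ x + 1) ∧
        ∀ x, m₁ x =
          (Real.sign (m₁ 0) * (∫ y in (0:ℝ)..1, |m₁ y| ^ (1 / lam)) ^ lam)
            * (deriv ξ x) ^ lam) := by
  obtain ⟨ξ₁, hξ₁, h₁⟩ := exists_isCircleDiffeoLift_eq_const_mul hlam hm₁ hm₁per hm₁0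
  obtain ⟨ξ₂, hξ₂, h₂⟩ := exists_isCircleDiffeoLift_eq_const_mul hlam hm₂ hm₂per hm₂0
  refine ⟨⟨?_, fun h => ?_⟩, ξ₁, hξ₁.1, hξ₁.2.1, hξ₁.2.2, h₁⟩
  · rintro ⟨ξ, hsmooth, hpos, hshift, h⟩
    have hξ : IsCircleDiffeoLift ξ := ⟨hsmooth, hpos, hshift⟩
    have hsign : Real.sign (m₂ 0) = Real.sign (m₁ 0) := by
      have hp := Real.rpow_pos_of_pos (hpos 0) lam
      rw [h 0, ← Real.sign_eq_of_continuous_of_ne_zero hm₁.continuous hm₁0 (ξ 0) 0]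
      rcases (hm₁0 (ξ 0)).lt_or_gt with hx | hx
      · rw [Real.sign_of_neg hx, Real.sign_of_neg (mul_neg_of_neg_of_pos hx hp)]
      · rw [Real.sign_of_pos hx, Real.sign_of_pos (mul_pos hx hp)]
    rw [hsign, funext h, hξ.integral_abs_rpow_eq hlam hm₁ hm₁per hm₁0]
  · obtain ⟨η, hη, hinv⟩ := hξ₁.exists_rightInverse
    have hξ := hη.comp hξ₂
    refine ⟨η ∘ ξ₂, hξ.1, hξ.2.1, hξ.2.2, fun x => ?_⟩
    have hd := deriv_comp x (hξ₁.differentiable _) (hξ.differentiable x)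
    rw [show ξ₁ ∘ (η ∘ ξ₂) = ξ₂ from funext fun x => hinv (ξ₂ x)] at hd
    rw [h₁ ((η ∘ ξ₂) x), mul_assoc, ← Real.mul_rpow (hξ₁.2.1 _).le (hξ.2.1 x).le, ← hd, h, ← h₂]
end

section
/- Let g : ℝ → ℝ be the periodic Green's function, i.e. the 1-periodic function with g(x) = x(x−1)/2 + 13/12 for x ∈ [0,1). Let m : ℝ → ℝ be continuous and 1-periodic, and define w(x) = ∫₀¹ g(x−y) m(y) dy. Then w is twice continuously differentiable and 1-periodic, and it satisfies (∫₀¹ w(y) dy) − w''(x) = m(x) for all x ∈ ℝ. Moreover w is the unique such function: if v is any twice continuously differentiable 1-periodic function with (∫₀¹ v(y) dy) − v''(x) = m(x) for all x, then v = w. -/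
open intervalIntegral

theorem hasDerivAt_integral_sub_one {f : ℝ → ℝ} (hf : Continuous f) (x : ℝ) :
    HasDerivAt (fun x => ∫ y in (x - 1)..x, f y) (f x - f (x - 1)) x := by
  have hF (z : ℝ) : HasDerivAt (fun x => ∫ y in (0:ℝ)..x, f y) (f z) z :=
    (hf.integral_hasStrictDerivAt 0 z).hasDerivAt
  refine ((hF x).sub ((hF (x - 1)).comp_sub_const x 1)).congr_of_eventuallyEq
    (.of_forall fun z => ?_)
  simpa using (integral_interval_sub_left (hf.intervalIntegrable 0 z)
    (hf.intervalIntegrable 0 (z - 1))).symm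

/-- The Green representation formula for a twice differentiable 1-periodic function. -/
theorem integral_green_mul_deriv_deriv {u u' u'' : ℝ → ℝ} (hu : ∀ x, HasDerivAt u (u' x) x)
    (hu' : ∀ x, HasDerivAt u' (u'' x) x) (hcont : Continuous u'') (hper : ∀ x, u (x + 1) = u x)
    (x : ℝ) :
    ∫ y in (0:ℝ)..1, (y * (y - 1) / 2 + 13 / 12) * u'' (x + y)
      = (∫ y in (0:ℝ)..1, u y) - u x := by
  have hper' : u' (x + 1) = u' x := by
    refine ((hu (x + 1)).comp_add_const x 1).unique ?_
    simpa only [hper] using hu x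
  have hcu : Continuous u := continuous_iff_continuousAt.2 fun z => (hu z).continuousAt
  have hmean : ∫ y in (0:ℝ)..1, u (x + y) = ∫ y in (0:ℝ)..1, u y := by
    have := Function.Periodic.intervalIntegral_add_eq (f := u) (T := 1) hper x 0
    simpa [integral_comp_add_left] using this
  have hderiv (y : ℝ) : HasDerivAt
      (fun y => (y * (y - 1) / 2 + 13 / 12) * u' (x + y) - (y - 1 / 2) * u (x + y))
      ((y * (y - 1) / 2 + 13 / 12) * u'' (x + y) - u (x + y)) y := by
    have h1 := (hu (x + y)).comp_const_add x y
    have h2 := (hu' (x + y)).comp_const_add x y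
    have h3 : HasDerivAt (fun y : ℝ => y * (y - 1) / 2 + 13 / 12) (y - 1 / 2) y := by
      refine ((((hasDerivAt_id y).mul ((hasDerivAt_id y).sub_const 1)).div_const 2).add_const
        (13 / 12)).congr_deriv ?_
      simp only [id]; ring
    refine ((h3.mul h2).sub (((hasDerivAt_id y).sub_const (1 / 2)).mul h1)).congr_deriv ?_
    simp only [id]; ring
  have hint₁ : Continuous fun y => (y * (y - 1) / 2 + 13 / 12) * u'' (x + y) := by fun_prop
  have hint₂ : Continuous fun y => u (x + y) := by fun_prop
  have hftc := integral_eq_sub_of_hasDerivAt (fun y _ => hderiv y)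
    ((hint₁.sub hint₂).intervalIntegrable 0 1)
  rw [integral_sub (hint₁.intervalIntegrable 0 1) (hint₂.intervalIntegrable 0 1), hmean] at hftc
  simp only [hper, hper', add_zero] at hftc
  linarith

theorem integral_green_mul_const_sub {f : ℝ → ℝ} (hf : Continuous f) (c x : ℝ) :
    ∫ y in (0:ℝ)..1, (y * (y - 1) / 2 + 13 / 12) * (c - f (x + y))
      = c - ∫ y in (0:ℝ)..1, (y * (y - 1) / 2 + 13 / 12) * f (x + y) := by
  have hP : ∫ y in (0:ℝ)..1, (y * (y - 1) / 2 + 13 / 12) * c = c := by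
    have hderiv (y : ℝ) : HasDerivAt (fun y : ℝ => (y ^ 3 / 6 - y ^ 2 / 4 + 13 / 12 * y) * c)
        ((y * (y - 1) / 2 + 13 / 12) * c) y := by
      refine ((((hasDerivAt_pow 3 y).div_const 6).sub ((hasDerivAt_pow 2 y).div_const 4)).add
        ((hasDerivAt_id y).const_mul (13 / 12))).mul_const c |>.congr_deriv ?_
      push_cast
      ring
    rw [integral_eq_sub_of_hasDerivAt (fun y _ => hderiv y)
      (Continuous.intervalIntegrable (by fun_prop) 0 1)]
    ring
  simp only [mul_sub]
  rw [integral_sub (Continuous.intervalIntegrable (by fun_prop) 0 1)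
    (Continuous.intervalIntegrable (by fun_prop) 0 1)]
  simpa only [mul_sub] using congrArg (· - _) hP

/-- The convolution of `m` with the periodic Green's function, over the period ending at `x`. -/
theorem integral_green_sub_mul {g m : ℝ → ℝ} (hgper : ∀ x, g (x + 1) = g x)
    (hgval : ∀ x ∈ Set.Ico (0:ℝ) 1, g x = x * (x - 1) / 2 + 13 / 12)
    (hmper : ∀ x, m (x + 1) = m x) (x : ℝ) :
    ∫ y in (0:ℝ)..1, g (x - y) * m y
      = ∫ y in (x - 1)..x, ((x - y) * (x - y - 1) / 2 + 13 / 12) * m y := by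
  have hper : Function.Periodic (fun y => g (x - y) * m y) 1 := fun y => by
    simp only [hmper]
    rw [← hgper (x - (y + 1))]
    ring_nf
  have h := hper.intervalIntegral_add_eq 0 (x - 1)
  rw [zero_add, sub_add_cancel] at h
  rw [h]
  refine integral_congr_Ioo_of_le (by linarith) fun y hy => ?_
  rw [hgval _ ⟨by linarith [hy.2], by linarith [hy.1]⟩]

theorem integral_quadratic_sub_mul {m : ℝ → ℝ} (hm : Continuous m) (x : ℝ) :
    ∫ y in (x - 1)..x, ((x - y) * (x - y - 1) / 2 + 13 / 12) * m y
      = (x * (x - 1) / 2 + 13 / 12) * (∫ y in (x - 1)..x, m y)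
        + (1 / 2 - x) * (∫ y in (x - 1)..x, y * m y)
        + 1 / 2 * ∫ y in (x - 1)..x, y ^ 2 * m y := by
  rw [← integral_const_mul, ← integral_const_mul, ← integral_const_mul, ← integral_add,
    ← integral_add]
  · congr 1
    ext y
    ring
  all_goals exact Continuous.intervalIntegrable (by fun_prop) _ _

/-- convolution with the periodic Green's function
`g(x) = x(x−1)/2 + 13/12` (on `[0,1)`) inverts the operator `Λ_μ² v = μ(v) − v''`
on 1-periodic functions, and the inverse is unique. -/
theorem green_function_inverts_Lambda_mu
    (g : ℝ → ℝ) (hgper : ∀ x, g (x + 1) = g x)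
    (hgval : ∀ x ∈ Set.Ico (0:ℝ) 1, g x = x * (x - 1) / 2 + 13 / 12)
    (m : ℝ → ℝ) (hm : Continuous m) (hmper : ∀ x, m (x + 1) = m x)
    (w : ℝ → ℝ) (hw : ∀ x : ℝ, w x = ∫ y in (0:ℝ)..1, g (x - y) * m y) :
    ContDiff ℝ 2 w ∧ (∀ x, w (x + 1) = w x) ∧
      (∀ x : ℝ, (∫ y in (0:ℝ)..1, w y) - deriv (deriv w) x = m x) ∧
      (∀ v : ℝ → ℝ, ContDiff ℝ 2 v → (∀ x, v (x + 1) = v x) →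
        (∀ x : ℝ, (∫ y in (0:ℝ)..1, v y) - deriv (deriv v) x = m x) → v = w) := by
  have hrepr (x : ℝ) := (hw x).trans (integral_green_sub_mul hgper hgval hmper x)
  set a := ∫ y in (0:ℝ)..1, m y
  have hmean (x : ℝ) : ∫ y in (x - 1)..x, m y = a := by
    have := Function.Periodic.intervalIntegral_add_eq (f := m) (T := 1) hmper (x - 1) 0
    simpa using this
  have hm1 (x : ℝ) : m (x - 1) = m x := by rw [← hmper (x - 1), sub_add_cancel]
  let w' : ℝ → ℝ := fun x => (x - 1 / 2) * a - ∫ y in (x - 1)..x, y * m y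
  have hB (x : ℝ) : HasDerivAt (fun x => ∫ y in (x - 1)..x, y * m y) (m x) x := by
    refine (hasDerivAt_integral_sub_one (by fun_prop) x).congr_deriv ?_
    rw [hm1]; ring
  have hC (x : ℝ) : HasDerivAt (fun x => ∫ y in (x - 1)..x, y ^ 2 * m y)
      ((2 * x - 1) * m x) x := by
    refine (hasDerivAt_integral_sub_one (by fun_prop) x).congr_deriv ?_
    rw [hm1]; ring
  have hw' (x : ℝ) : HasDerivAt w (w' x) x := by
    have hP : HasDerivAt (fun x : ℝ => x * (x - 1) / 2 + 13 / 12) (x - 1 / 2) x := by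
      refine ((((hasDerivAt_id x).mul ((hasDerivAt_id x).sub_const 1)).div_const 2).add_const
        (13 / 12)).congr_deriv ?_
      simp only [id]; ring
    refine ((((hP.mul_const a).add (((hasDerivAt_id x).const_sub (1 / 2)).mul (hB x))).add
      ((hC x).const_mul (1 / 2))).congr_deriv ?_).congr_of_eventuallyEq (.of_forall fun z => ?_)
    · simp only [id, w']; ring
    · rw [hrepr, integral_quadratic_sub_mul hm, hmean]; rfl
  have hw'' (x : ℝ) : HasDerivAt w' (a - m x) x := by
    refine ((((hasDerivAt_id x).sub_const (1 / 2)).mul_const a).sub (hB x)).congr_deriv ?_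
    ring
  have hdw : deriv w = w' := funext fun x => (hw' x).deriv
  have hdw' : deriv w' = fun x => a - m x := funext fun x => (hw'' x).deriv
  have hwper (x : ℝ) : w (x + 1) = w x := by
    rw [hw, hw]
    congr 1
    ext y
    rw [← hgper (x - y)]
    ring_nf
  have hgreen (x : ℝ) := integral_green_mul_deriv_deriv hw' hw'' (by fun_prop) hwper x
  have hmu : ∫ y in (0:ℝ)..1, w y = a := by
    have h := hgreen 1
    rw [integral_green_mul_const_sub hm] at h
    have h1 : w 1 = ∫ y in (0:ℝ)..1, (y * (y - 1) / 2 + 13 / 12) * m (1 + y) := by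
      rw [hrepr, sub_self]
      congr 1
      ext y
      rw [add_comm 1 y, hmper]
      ring
    linarith
  refine ⟨?_, hwper, fun x => by rw [hdw, hdw', hmu]; ring, fun v hv hvper hveq => ?_⟩
  · refine (contDiff_succ_iff_deriv (n := 1)).2
      ⟨fun x => (hw' x).differentiableAt, by simp, ?_⟩
    rw [hdw, contDiff_one_iff_deriv, hdw']
    exact ⟨fun x => (hw'' x).differentiableAt, by fun_prop⟩
  · obtain ⟨hv₁, -, hv₂⟩ := (contDiff_succ_iff_deriv (n := 1)).1 hv
    obtain ⟨hv₂, hv₃⟩ := contDiff_one_iff_deriv.1 hv₂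
    have hdv : deriv (deriv v) = fun x => (∫ y in (0:ℝ)..1, v y) - m x :=
      funext fun x => by linarith [hveq x]
    ext x
    have h := integral_green_mul_deriv_deriv (fun z => (hv₁ z).hasDerivAt)
      (fun z => (hv₂ z).hasDerivAt) hv₃ hvper x
    have h' := hgreen x
    rw [hdv, integral_green_mul_const_sub hm] at h
    rw [integral_green_mul_const_sub hm] at h'
    linarith
end

section
/- Let g : ℝ → ℝ be the periodic Green's function, i.e. the 1-periodic function with g(x) = x(x−1)/2 + 13/12 for x ∈ [0,1), and let g' : ℝ → ℝ be its regularized derivative, i.e. the 1-periodic function with g'(0) = 0 and g'(x) = x − 1/2 for 0 < x < 1. Then for all x, q ∈ ℝ the following two convolution identities hold: (i) ∫₀¹ g'(x−y) g(y−q) dy = −(1/3) ( g(x−q) − 13/12 ) g'(x−q); (ii) ∫₀¹ g'(x−y) g'(y−q) dy = 1 − g(x−q). -/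
open intervalIntegral

theorem integral_linear_mul_quadratic (s a b c u v : ℝ) :
    (∫ z in u..v, (s - z) * (a * z ^ 2 + b * z + c))
      = (-a * v ^ 4 / 4 + (s * a - b) * v ^ 3 / 3 + (s * b - c) * v ^ 2 / 2 + s * c * v)
        - (-a * u ^ 4 / 4 + (s * a - b) * u ^ 3 / 3 + (s * b - c) * u ^ 2 / 2 + s * c * u) := by
  refine integral_eq_sub_of_hasDerivAt
    (f := fun z ↦ -a * z ^ 4 / 4 + (s * a - b) * z ^ 3 / 3 + (s * b - c) * z ^ 2 / 2 + s * c * z)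
    (fun z _ ↦ ?_) (Continuous.intervalIntegrable (by fun_prop) _ _)
  refine ((((((hasDerivAt_pow 4 z).const_mul (-a)).div_const 4).add
    (((hasDerivAt_pow 3 z).const_mul (s * a - b)).div_const 3)).add
    (((hasDerivAt_pow 2 z).const_mul (s * b - c)).div_const 2)).add
    ((hasDerivAt_id z).const_mul (s * c))).congr_deriv ?_
  norm_num
  ring

/-- The convolution over one period of the 1-periodic sawtooth `g'` with a 1-periodic function
that agrees with a continuous function `p` on `(0, 1)`. -/
theorem integral_sawtooth_convolution {g' h p : ℝ → ℝ}
    (hg'per : Function.Periodic g' 1)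
    (hg'val : ∀ x ∈ Set.Ioo (0 : ℝ) 1, g' x = x - 1 / 2)
    (hper : Function.Periodic h 1) (hp : Continuous p)
    (hval : ∀ x ∈ Set.Ioo (0 : ℝ) 1, h x = p x) (x q : ℝ) :
    (∫ y in (0 : ℝ)..1, g' (x - y) * h (y - q))
      = (∫ z in (0 : ℝ)..Int.fract (x - q), (Int.fract (x - q) - 1 / 2 - z) * p z)
        + ∫ z in Int.fract (x - q)..1, (Int.fract (x - q) + 1 / 2 - z) * p z := by
  set t := Int.fract (x - q) with ht
  have ht0 : 0 ≤ t := Int.fract_nonneg _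
  have ht1 : t < 1 := Int.fract_lt_one _
  have hshift (z : ℝ) : g' (x - q - z) = g' (t - z) := by
    have := (hg'per.int_mul ⌊x - q⌋) (t - z)
    rw [← this]
    congr 1
    linarith [Int.fract_add_floor (x - q)]
  have hG : Function.Periodic (fun z ↦ g' (t - z) * h z) 1 := fun z ↦ by
    have h1 := hg'per (t - (z + 1))
    simp only [hper z, ← h1]
    congr 2
    ring
  have hleft : Set.EqOn (fun z ↦ (t - 1 / 2 - z) * p z) (fun z ↦ g' (t - z) * h z)
      (Set.Ioo 0 t) := fun z hz ↦ by
    simp only [hg'val (t - z) ⟨by linarith [hz.2], by linarith [hz.1]⟩,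
      hval z ⟨hz.1, hz.2.trans ht1⟩]
    ring
  have hright : Set.EqOn (fun z ↦ (t + 1 / 2 - z) * p z) (fun z ↦ g' (t - z) * h z)
      (Set.Ioo t 1) := fun z hz ↦ by
    simp only [← hg'per (t - z), hg'val (t - z + 1) ⟨by linarith [hz.2], by linarith [hz.1]⟩,
      hval z ⟨ht0.trans_lt hz.1, hz.2⟩]
    ring
  rw [← Set.uIoo_of_le ht0] at hleft
  rw [← Set.uIoo_of_le ht1.le] at hright
  have hint_left : IntervalIntegrable (fun z ↦ g' (t - z) * h z) MeasureTheory.volume 0 t :=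
    (Continuous.intervalIntegrable (by fun_prop) 0 t).congr_uIoo hleft
  have hint_right : IntervalIntegrable (fun z ↦ g' (t - z) * h z) MeasureTheory.volume t 1 :=
    (Continuous.intervalIntegrable (by fun_prop) t 1).congr_uIoo hright
  calc (∫ y in (0 : ℝ)..1, g' (x - y) * h (y - q))
      = ∫ y in (0 : ℝ)..1, g' (t - (y - q)) * h (y - q) := by
        congr 1 with y
        rw [← hshift]
        congr 2
        ring
    _ = ∫ z in (0 - q)..(1 - q), g' (t - z) * h z :=
        integral_comp_sub_right (fun z ↦ g' (t - z) * h z) q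
    _ = ∫ z in (0 : ℝ)..1, g' (t - z) * h z := by
        have := hG.intervalIntegral_add_eq (0 - q) 0
        rwa [zero_add, show 0 - q + 1 = 1 - q by ring] at this
    _ = _ := by
        rw [← integral_add_adjacent_intervals hint_left hint_right,
          integral_congr_uIoo hleft, integral_congr_uIoo hright]

/-- the convolution identities `g' ∗ g_q = −(1/3)(g_q − 13/12) g_q'` and
`g' ∗ g_q' = 1 − g_q` for the periodic Green's function `g` and its regularized
derivative `g'`. -/
theorem green_convolution_identities
    (g g' : ℝ → ℝ)
    (hgper : ∀ x, g (x + 1) = g x)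
    (hgval : ∀ x ∈ Set.Ico (0:ℝ) 1, g x = x * (x - 1) / 2 + 13 / 12)
    (hg'per : ∀ x, g' (x + 1) = g' x)
    (hg'0 : g' 0 = 0)
    (hg'val : ∀ x ∈ Set.Ioo (0:ℝ) 1, g' x = x - 1 / 2) :
    ∀ x q : ℝ,
      (∫ y in (0:ℝ)..1, g' (x - y) * g (y - q))
          = -(1 / 3) * (g (x - q) - 13 / 12) * g' (x - q) ∧
      (∫ y in (0:ℝ)..1, g' (x - y) * g' (y - q)) = 1 - g (x - q) := by
  intro x q
  have hfract {f : ℝ → ℝ} (hf : Function.Periodic f 1) : f (x - q) = f (Int.fract (x - q)) := by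
    rw [← hf.sub_int_mul_eq ⌊x - q⌋, mul_one, Int.self_sub_floor]
  have ht0 : 0 ≤ Int.fract (x - q) := Int.fract_nonneg _
  have ht1 : Int.fract (x - q) < 1 := Int.fract_lt_one _
  rw [integral_sawtooth_convolution (p := fun z ↦ 1 / 2 * z ^ 2 + -(1 / 2) * z + 13 / 12)
      hg'per hg'val hgper (by fun_prop)
      (fun z hz ↦ by rw [hgval z (Set.Ioo_subset_Ico_self hz)]; ring),
    integral_sawtooth_convolution (p := fun z ↦ 0 * z ^ 2 + 1 * z + -(1 / 2))
      hg'per hg'val hg'per (by fun_prop) (fun z hz ↦ by rw [hg'val z hz]; ring),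
    hfract hgper, hfract hg'per, hgval _ ⟨ht0, ht1⟩]
  simp only [integral_linear_mul_quadratic]
  refine ⟨?_, by ring⟩
  rcases ht0.eq_or_lt with h | h
  · rw [← h, hg'0]
    norm_num
  · rw [hg'val _ ⟨h, ht1⟩]
    ring
end

section
/- Let g : ℝ → ℝ be the periodic Green's function, i.e. the 1-periodic function with g(x) = x(x−1)/2 + 13/12 for x ∈ [0,1), and let g' : ℝ → ℝ be its regularized derivative, i.e. the 1-periodic function with g'(0) = 0 and g'(x) = x − 1/2 for 0 < x < 1. Write gᵢ = g(x−qᵢ), gᵢ' = g'(x−qᵢ). Then: (i) for all x, qᵢ, qⱼ ∈ ℝ, −(gᵢ − gⱼ)(gᵢ' − gⱼ') = 2 g'(qᵢ−qⱼ) gᵢ + 2 g'(qⱼ−qᵢ) gⱼ + ( g(qᵢ−qⱼ) − 13/12 ) gᵢ' + ( g(qⱼ−qᵢ) − 13/12 ) gⱼ'; and (ii) for all x, qᵢ, qⱼ ∈ ℝ such that not both x − qᵢ ∈ ℤ and x − qⱼ ∈ ℤ, gᵢ' gⱼ' = gᵢ + gⱼ + g'(qᵢ−qⱼ)(gᵢ'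 − gⱼ') + g(qᵢ−qⱼ) − 3. -/
/-- pointwise algebraic identities for the periodic Green's function `g`
and its regularized derivative `g'`, used in the multi-peakon and shock-peakon
computations. -/
theorem green_pointwise_identities
    (g g' : ℝ → ℝ)
    (hgper : ∀ x, g (x + 1) = g x)
    (hgval : ∀ x ∈ Set.Ico (0:ℝ) 1, g x = x * (x - 1) / 2 + 13 / 12)
    (hg'per : ∀ x, g' (x + 1) = g' x)
    (hg'0 : g' 0 = 0)
    (hg'val : ∀ x ∈ Set.Ioo (0:ℝ) 1, g' x = x - 1 / 2) :
    (∀ x qi qj : ℝ,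
      -((g (x - qi) - g (x - qj)) * (g' (x - qi) - g' (x - qj)))
        = 2 * g' (qi - qj) * g (x - qi) + 2 * g' (qj - qi) * g (x - qj)
          + (g (qi - qj) - 13 / 12) * g' (x - qi)
          + (g (qj - qi) - 13 / 12) * g' (x - qj)) ∧
    (∀ x qi qj : ℝ, ¬((∃ n : ℤ, x - qi = n) ∧ (∃ n : ℤ, x - qj = n)) →
      g' (x - qi) * g' (x - qj)
        = g (x - qi) + g (x - qj) + g' (qi - qj) * (g' (x - qi) - g' (x - qj))
          + g (qi - qj) - 3) := by
  have hg_shift : ∀ (y : ℝ) (n : ℤ), g (y + n) = g y := fun y n => by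
    simpa using Function.Periodic.int_mul (c := 1) hgper n y
  have hg'_shift : ∀ (y : ℝ) (n : ℤ), g' (y + n) = g' y := fun y n => by
    simpa using Function.Periodic.int_mul (c := 1) hg'per n y
  have hg_zero : g 0 = 13 / 12 := by
    rw [hgval 0 (by norm_num)]; norm_num
  have hg_neg : ∀ d ∈ Set.Ioo (0 : ℝ) 1, g (-d) = d * (d - 1) / 2 + 13 / 12 := by
    rintro d ⟨h0, h1⟩
    rw [← hgper, hgval _ ⟨by linarith, by linarith⟩]; ring
  have hg'_neg : ∀ d ∈ Set.Ioo (0 : ℝ) 1, g' (-d) = 1 / 2 - d := by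
    rintro d ⟨h0, h1⟩
    rw [← hg'per, hg'val _ ⟨by linarith, by linarith⟩]; ring
  have decompose : ∀ x qi qj : ℝ, ∃ a ∈ Set.Ico (0 : ℝ) 1, ∃ b ∈ Set.Ico (0 : ℝ) 1,
      ∃ m n : ℤ, x - qi = a + m ∧ x - qj = b + n ∧
        qi - qj = (b - a) + (n - m : ℤ) ∧ qj - qi = -(b - a) + (m - n : ℤ) := by
    intro x qi qj
    have hi := Int.fract_add_floor (x - qi)
    have hj := Int.fract_add_floor (x - qj)
    refine ⟨_, ⟨Int.fract_nonneg (x - qi), Int.fract_lt_one _⟩, _,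
      ⟨Int.fract_nonneg (x - qj), Int.fract_lt_one _⟩, _, _, hi.symm, hj.symm, ?_, ?_⟩ <;>
    · push_cast
      linarith
  constructor
  · intro x qi qj
    obtain ⟨a, ha, b, hb, m, n, h1, h2, h3, h4⟩ := decompose x qi qj
    rw [h1, h2, h3, h4]
    simp only [hg_shift, hg'_shift]
    rcases lt_trichotomy a b with hab | rfl | hab
    · have hd : b - a ∈ Set.Ioo (0 : ℝ) 1 := ⟨by linarith, by linarith [ha.1, hb.2]⟩
      rw [hg_neg _ hd, hg'_neg _ hd, hgval _ (Set.Ioo_subset_Ico_self hd), hg'val _ hd,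
        hgval a ha, hgval b hb, hg'val b ⟨ha.1.trans_lt hab, hb.2⟩]
      rcases ha.1.eq_or_lt with rfl | ha0
      · rw [hg'0]; ring
      · rw [hg'val a ⟨ha0, ha.2⟩]; ring
    · simp [hg'0, hg_zero]
    · have hd : a - b ∈ Set.Ioo (0 : ℝ) 1 := ⟨by linarith, by linarith [hb.1, ha.2]⟩
      rw [neg_sub, ← neg_sub a b, hg_neg _ hd, hg'_neg _ hd,
        hgval _ (Set.Ioo_subset_Ico_self hd), hg'val _ hd,
        hgval a ha, hgval b hb, hg'val a ⟨hb.1.trans_lt hab, ha.2⟩]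
      rcases hb.1.eq_or_lt with rfl | hb0
      · rw [hg'0]; ring
      · rw [hg'val b ⟨hb0, hb.2⟩]; ring
  · intro x qi qj hx
    obtain ⟨a, ha, b, hb, m, n, h1, h2, h3, -⟩ := decompose x qi qj
    rw [h1, h2] at hx ⊢
    rw [h3]
    simp only [hg_shift, hg'_shift]
    rcases lt_trichotomy a b with hab | rfl | hab
    · have hd : b - a ∈ Set.Ioo (0 : ℝ) 1 := ⟨by linarith, by linarith [ha.1, hb.2]⟩
      rw [hgval _ (Set.Ioo_subset_Ico_self hd), hg'val _ hd,
        hgval a ha, hgval b hb, hg'val b ⟨ha.1.trans_lt hab, hb.2⟩]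
      rcases ha.1.eq_or_lt with rfl | ha0
      · rw [hg'0]; ring
      · rw [hg'val a ⟨ha0, ha.2⟩]; ring
    · have ha0 : 0 < a := by
        refine ha.1.lt_of_ne ?_
        rintro rfl
        exact hx ⟨⟨m, zero_add _⟩, ⟨n, zero_add _⟩⟩
      rw [sub_self, hg'0, hg_zero, hgval a ha, hg'val a ⟨ha0, ha.2⟩]
      ring
    · have hd : a - b ∈ Set.Ioo (0 : ℝ) 1 := ⟨by linarith, by linarith [hb.1, ha.2]⟩
      rw [← neg_sub a b, hg_neg _ hd, hg'_neg _ hd,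
        hgval a ha, hgval b hb, hg'val a ⟨hb.1.trans_lt hab, ha.2⟩]
      rcases hb.1.eq_or_lt with rfl | hb0
      · rw [hg'0]; ring
      · rw [hg'val b ⟨hb0, hb.2⟩]; ring
end

section
/- Let λ ∈ ℝ and c ∈ ℝ. Let φ : ℝ → ℝ be the 1-periodic function with φ(x) = (c/26)(12x² + 23) for x ∈ [−1/2, 1/2), and define u(t,x) = φ(x − ct). Then: (i) ∫₀¹ φ(x) dx = 12c/13; and (ii) for every (t,x) ∈ ℝ × ℝ with x − ct − 1/2 ∉ ℤ, u is differentiable at (t,x) and satisfies the μ-equation in its nonlocal form: u_t(t,x) + u(t,x) u_x(t,x) + λ (12c/13) ∫₀¹ g'(x−y) u(t,y) dy + ((3−λ)/2) ∫₀¹ g'(x−y) u_x(t,y)² dy = 0, where u_x(t,y) denotes the spatial derivative (defined for y − ct − 1/2 ∉ ℤ). Thus u is a peaked period-one traveling wave of the μ-equation, traveling with speed c equal to its height at the peak. -/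
open intervalIntegral

/-- Over one period, the integral of a `1`-periodic function equal to `a x² + b` on
`(-1/2, 1/2)` against the shifted kernel `g'` is `a (z / 12 - z³ / 3)`, where `z` is the
representative of the shift in `(-1/2, 1/2)`. -/
theorem integral_periodic_kernel_mul_quadratic
    {g' f : ℝ → ℝ} (hg'per : Function.Periodic g' 1)
    (hg'val : ∀ x ∈ Set.Ioo (0:ℝ) 1, g' x = x - 1 / 2)
    (hfper : Function.Periodic f 1) {a b : ℝ}
    (hfval : ∀ x ∈ Set.Ioo (-(1:ℝ)/2) (1/2), f x = a * x ^ 2 + b)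
    {x s z : ℝ} {n : ℤ} (hz : z ∈ Set.Ioo (-(1:ℝ)/2) (1/2)) (hx : x - s = z + n) :
    ∫ y in (0:ℝ)..1, g' (x - y) * f (y - s) = a * (z / 12 - z ^ 3 / 3) := by
  obtain ⟨hz₁, hz₂⟩ := hz
  have hshift (w : ℝ) : g' (x - s - w) = g' (z - w) := by
    have h := hg'per.int_mul n (z - w)
    rw [← h, hx]
    congr 1
    ring
  have hper : Function.Periodic (fun w => g' (z - w) * f w) 1 := fun w => by
    have h := hg'per (z - (w + 1))
    simp only [hfper w, ← h]
    congr 2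
    ring
  have hsub : ∫ y in (0:ℝ)..1, g' (x - y) * f (y - s)
      = ∫ w in (-(1:ℝ)/2)..(1/2), g' (z - w) * f w := by
    have h₁ : ∫ y in (0:ℝ)..1, g' (x - y) * f (y - s)
        = ∫ y in (0:ℝ)..1, (fun w => g' (z - w) * f w) (y - s) := by
      congr 1
      ext y
      simp only [← hshift]
      congr 2
      ring
    rw [h₁, integral_comp_sub_right (fun w => g' (z - w) * f w) s]
    have h₂ := hper.intervalIntegral_add_eq (0 - s) (-(1:ℝ)/2)
    rwa [show 0 - s + 1 = 1 - s by ring, show -(1:ℝ)/2 + 1 = 1/2 by ring] at h₂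
  have hleft : Set.EqOn (fun w => (z - w + -(1/2)) * (a * w ^ 2 + b))
      (fun w => g' (z - w) * f w) (Set.Ioo (-(1:ℝ)/2) z) := by
    rintro w ⟨hw₁, hw₂⟩
    simp only
    rw [hfval w ⟨hw₁, by linarith⟩, hg'val (z - w) ⟨by linarith, by linarith⟩]
    ring
  have hright : Set.EqOn (fun w => (z - w + 1/2) * (a * w ^ 2 + b))
      (fun w => g' (z - w) * f w) (Set.Ioo z (1/2)) := by
    rintro w ⟨hw₁, hw₂⟩
    simp only
    rw [hfval w ⟨by linarith, hw₂⟩, ← hg'per (z - w),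
      hg'val (z - w + 1) ⟨by linarith, by linarith⟩]
    ring
  have hpoly (d p q : ℝ) : ∫ w in p..q, (z - w + d) * (a * w ^ 2 + b)
      = (a * (z + d) * q ^ 3 / 3 + b * (z + d) * q - a * q ^ 4 / 4 - b * q ^ 2 / 2)
        - (a * (z + d) * p ^ 3 / 3 + b * (z + d) * p - a * p ^ 4 / 4 - b * p ^ 2 / 2) := by
    refine integral_eq_sub_of_hasDerivAt
      (f := fun w => a * (z + d) * w ^ 3 / 3 + b * (z + d) * w - a * w ^ 4 / 4 - b * w ^ 2 / 2)
      (fun w _ => ?_) (Continuous.intervalIntegrable (by fun_prop) _ _)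
    have h := (((((hasDerivAt_pow 3 w).const_mul (a * (z + d))).div_const 3).add
      ((hasDerivAt_id w).const_mul (b * (z + d)))).sub
      (((hasDerivAt_pow 4 w).const_mul a).div_const 4)).sub
      (((hasDerivAt_pow 2 w).const_mul b).div_const 2)
    refine h.congr_deriv ?_
    push_cast
    ring
  have hcl : ∫ w in (-(1:ℝ)/2)..z, g' (z - w) * f w
      = ∫ w in (-(1:ℝ)/2)..z, (z - w + -(1/2)) * (a * w ^ 2 + b) :=
    (integral_congr_Ioo_of_le hz₁.le hleft).symm
  have hcr : ∫ w in z..(1/2), g' (z - w) * f w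
      = ∫ w in z..(1/2), (z - w + 1/2) * (a * w ^ 2 + b) :=
    (integral_congr_Ioo_of_le hz₂.le hright).symm
  have hil : IntervalIntegrable (fun w => g' (z - w) * f w) MeasureTheory.volume (-(1:ℝ)/2) z :=
    (intervalIntegrable_congr_uIoo (Set.uIoo_of_le hz₁.le ▸ hleft)).mp
      (Continuous.intervalIntegrable (by fun_prop) _ _)
  have hir : IntervalIntegrable (fun w => g' (z - w) * f w) MeasureTheory.volume z (1/2) :=
    (intervalIntegrable_congr_uIoo (Set.uIoo_of_le hz₂.le ▸ hright)).mp
      (Continuous.intervalIntegrable (by fun_prop) _ _)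
  rw [hsub, ← integral_add_adjacent_intervals hil hir, hcl, hcr, hpoly, hpoly]
  ring

/-- the 1-periodic profile `φ(x) = (c/26)(12x² + 23)` on `[−1/2, 1/2)`
gives a peaked period-one traveling wave `u(t,x) = φ(x − ct)` of the μ-equation:
its mean is `12c/13`, and away from the peaks u satisfies the nonlocal form of the
μ-equation pointwise. -/
theorem mu_equation_one_peakon
    (lam c : ℝ)
    (g' : ℝ → ℝ) (hg'per : ∀ x, g' (x + 1) = g' x) (hg'0 : g' 0 = 0)
    (hg'val : ∀ x ∈ Set.Ioo (0:ℝ) 1, g' x = x - 1 / 2)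
    (φ : ℝ → ℝ) (hφper : ∀ x, φ (x + 1) = φ x)
    (hφval : ∀ x ∈ Set.Ico (-(1:ℝ)/2) (1/2), φ x = c / 26 * (12 * x ^ 2 + 23))
    (u : ℝ × ℝ → ℝ) (hu : ∀ t x : ℝ, u (t, x) = φ (x - c * t)) :
    ((∫ x in (0:ℝ)..1, φ x) = 12 * c / 13) ∧
    ∀ t x : ℝ, (¬∃ n : ℤ, x - c * t - 1 / 2 = n) →
      DifferentiableAt ℝ u (t, x) ∧
      pdt u (t, x) + u (t, x) * pdx u (t, x)
        + lam * (12 * c / 13) * (∫ y in (0:ℝ)..1, g' (x - y) * u (t, y))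
        + (3 - lam) / 2 * (∫ y in (0:ℝ)..1, g' (x - y) * (pdx u (t, y)) ^ 2) = 0 := by
  have hφP : Function.Periodic φ 1 := hφper
  have hgP : Function.Periodic g' 1 := hg'per
  have hφderiv {z : ℝ} (hz : z ∈ Set.Ioo (-(1:ℝ)/2) (1/2)) (n : ℤ) :
      HasDerivAt φ (12 * c / 13 * z) (z + n) := by
    have hpoly : HasDerivAt (fun x : ℝ => c / 26 * (12 * x ^ 2 + 23)) (12 * c / 13 * z) z := by
      refine ((((hasDerivAt_pow 2 z).const_mul 12).add_const 23).const_mul (c / 26)).congr_deriv ?_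
      push_cast
      ring
    have hφz : HasDerivAt φ (12 * c / 13 * z) z :=
      hpoly.congr_of_eventuallyEq <| by
        filter_upwards [isOpen_Ioo.mem_nhds hz] with w hw
        exact hφval w (Set.Ioo_subset_Ico_self hw)
    have hshift : φ = fun x => φ (x - n) := by
      ext x
      simpa using (hφP.sub_int_mul_eq n (x := x)).symm
    rw [hshift]
    exact HasDerivAt.comp_sub_const (z + n) (n : ℝ) (by simpa using hφz)
  have hpdx (t y : ℝ) : pdx u (t, y) = deriv φ (y - c * t) := by
    simp only [pdx, hu]
    exact deriv_comp_sub_const φ (c * t) y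
  have hdP : Function.Periodic (fun x => deriv φ x ^ 2) 1 := fun x => by
    have h : deriv φ (x + 1) = deriv φ x := by
      rw [← deriv_comp_add_const φ 1 x]
      simp only [hφper]
    simp only [h]
  refine ⟨?_, fun t x hpeak => ?_⟩
  · have h := hφP.intervalIntegral_add_eq 0 (-(1:ℝ)/2)
    rw [zero_add, show -(1:ℝ)/2 + 1 = 1/2 by ring] at h
    rw [h, integral_congr_Ioo_of_le (g := fun x => c / 26 * (12 * x ^ 2 + 23)) (by norm_num)
      fun x hx => hφval x (Set.Ioo_subset_Ico_self hx)]
    rw [integral_const_mul, integral_add (Continuous.intervalIntegrable (by fun_prop) _ _)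
      (Continuous.intervalIntegrable (by fun_prop) _ _), integral_const_mul, integral_pow,
      integral_const]
    norm_num
    ring
  obtain ⟨n, z, hz, hxz⟩ : ∃ (n : ℤ) (z : ℝ), z ∈ Set.Ioo (-(1:ℝ)/2) (1/2) ∧
      x - c * t = z + n := by
    refine ⟨⌊x - c * t + 1/2⌋, x - c * t - ⌊x - c * t + 1/2⌋, ⟨?_, ?_⟩, by ring⟩
    · refine lt_of_le_of_ne (by linarith [Int.floor_le (x - c * t + 1/2)]) fun h => hpeak
        ⟨⌊x - c * t + 1/2⌋ - 1, ?_⟩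
      push_cast
      linarith
    · linarith [Int.lt_floor_add_one (x - c * t + 1/2)]
  have hd : HasDerivAt φ (12 * c / 13 * z) (x - c * t) := hxz ▸ hφderiv hz n
  have hφx : φ (x - c * t) = c / 26 * (12 * z ^ 2 + 23) := by
    rw [← hφval z (Set.Ioo_subset_Ico_self hz), hxz]
    simpa using hφP.int_mul n z
  have hpdt : pdt u (t, x) = -c * (12 * c / 13 * z) := by
    have hinner : HasDerivAt (fun s : ℝ => x - c * s) (-c) t := by
      simpa using ((hasDerivAt_id t).const_mul c).const_sub x
    have h := (hd.comp t hinner).deriv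
    simp only [pdt, hu]
    rw [mul_comm]
    exact h
  have hint₁ : ∫ y in (0:ℝ)..1, g' (x - y) * u (t, y)
      = 6 * c / 13 * (z / 12 - z ^ 3 / 3) := by
    simp only [hu]
    refine integral_periodic_kernel_mul_quadratic (b := 23 * c / 26) hgP hg'val hφP
      (fun w hw => ?_) hz hxz
    rw [hφval w (Set.Ioo_subset_Ico_self hw)]
    ring
  have hint₂ : ∫ y in (0:ℝ)..1, g' (x - y) * (pdx u (t, y)) ^ 2
      = (12 * c / 13) ^ 2 * (z / 12 - z ^ 3 / 3) := by
    simp only [hpdx]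
    refine integral_periodic_kernel_mul_quadratic (f := fun w => deriv φ w ^ 2) (b := 0)
      hgP hg'val hdP (fun w hw => ?_) hz hxz
    have h : HasDerivAt φ (12 * c / 13 * w) w := by simpa using hφderiv hw 0
    simp only [h.deriv]
    ring
  refine ⟨?_, ?_⟩
  · have hueq : u = φ ∘ fun p : ℝ × ℝ => p.2 - c * p.1 := by
      ext ⟨s, y⟩
      exact hu s y
    rw [hueq]
    exact DifferentiableAt.comp (t, x) hd.differentiableAt (by fun_prop)
  · rw [hint₁, hint₂, hpdt, hpdx, hd.deriv, hu, hφx]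
    ring
end

section
/- Let N ≥ 1, let I ⊆ ℝ be an open interval, and let qᵢ, pᵢ, sᵢ : I → ℝ (i = 1,…,N) be continuously differentiable with qᵢ(t) − qⱼ(t) ∉ ℤ for all i ≠ j and all t ∈ I. Define the shock-peakon u(t,x) = Σᵢ ( pᵢ(t) g(x − qᵢ(t)) + sᵢ(t) g'(x − qᵢ(t)) ). Suppose the shock-peakon ODE system holds for all t and i: dqᵢ/dt = u(t, qᵢ(t)) (evaluated with the convention g'(0)=0), dpᵢ/dt = 2 ( sᵢ Σⱼ pⱼ − pᵢ (Σⱼ pⱼ g'(qᵢ−qⱼ) + Σⱼ sⱼ) ), and dsᵢ/dt = − sᵢ (Σⱼ pⱼ g'(qᵢ−qⱼ) + Σⱼ sⱼ). Then for every t ∈ I and every x ∈ ℝ with x − qᵢ(t) ∉ ℤ for all i, u is differentiable at (t,x) and satisfies the μDP equation in its nonlocal form: u_t(t,x) + u(t,x) u_x(t,x) + 3 (∫₀¹ u(t,y) dy) ∫₀¹ g'(x−y) u(t,y) dy = 0. -/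
open intervalIntegral

/-- A `1`-periodic function is determined by its values on `(0, 1)` away from the integers. -/
lemma periodic_eq_of_Ioo {k K : ℝ → ℝ} (hk : ∀ x, k (x + 1) = k x)
    (hK : ∀ x ∈ Set.Ioo (0 : ℝ) 1, k x = K x) {y : ℝ} {n : ℤ}
    (hy : y ∈ Set.Ioo (n : ℝ) (n + 1)) : k y = K (y - n) := by
  have hper : Function.Periodic k 1 := hk
  have h := hper.sub_int_mul_eq (x := y) n
  rw [mul_one] at h
  rw [← h, hK _ ⟨by linarith [hy.1], by linarith [hy.2]⟩]

lemma mem_Ioo_floor {y : ℝ} (hy : ¬∃ n : ℤ, y = n) :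
    y ∈ Set.Ioo (⌊y⌋ : ℝ) (⌊y⌋ + 1) :=
  ⟨lt_of_le_of_ne (Int.floor_le y) fun h => hy ⟨_, h.symm⟩, Int.lt_floor_add_one y⟩

lemma hasDerivAt_periodic_of_Ioo {k K : ℝ → ℝ} (hk : ∀ x, k (x + 1) = k x)
    (hK : ∀ x ∈ Set.Ioo (0 : ℝ) 1, k x = K x) {y K' : ℝ} (hy : ¬∃ n : ℤ, y = n)
    (hd : HasDerivAt K K' (Int.fract y)) : HasDerivAt k K' y := by
  have h : HasDerivAt (fun z => K (z - ⌊y⌋)) K' y := HasDerivAt.comp_sub_const y (⌊y⌋ : ℝ) hd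
  refine h.congr_of_eventuallyEq ?_
  filter_upwards [isOpen_Ioo.mem_nhds (mem_Ioo_floor hy)] with z hz
  exact periodic_eq_of_Ioo hk hK hz

/-- An integrand given by continuous formulas on the two sides of a point. -/
lemma integral_of_piecewise {F P Q : ℝ → ℝ} {a b c : ℝ} (hab : a ≤ b) (hbc : b ≤ c)
    (hP : Continuous P) (hQ : Continuous Q) (hFP : ∀ z ∈ Set.Ioo a b, F z = P z)
    (hFQ : ∀ z ∈ Set.Ioo b c, F z = Q z) :
    IntervalIntegrable F MeasureTheory.volume a c ∧
      ∫ z in a..c, F z = (∫ z in a..b, P z) + ∫ z in b..c, Q z := by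
  have h1 : IntervalIntegrable F MeasureTheory.volume a b :=
    (hP.intervalIntegrable a b).congr_uIoo fun z hz => by
      rw [Set.uIoo_of_le hab] at hz; exact (hFP z hz).symm
  have h2 : IntervalIntegrable F MeasureTheory.volume b c :=
    (hQ.intervalIntegrable b c).congr_uIoo fun z hz => by
      rw [Set.uIoo_of_le hbc] at hz; exact (hFQ z hz).symm
  refine ⟨h1.trans h2, ?_⟩
  rw [← intervalIntegral.integral_add_adjacent_intervals h1 h2,
    intervalIntegral.integral_congr_Ioo_of_le hab hFP, intervalIntegral.integral_congr_Ioo_of_le hbc hFQ]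

/-- Periodic convolution of two functions given by continuous formulas on `(0, 1)`. -/
lemma periodic_convolution {w W k K : ℝ → ℝ} (hw : ∀ x, w (x + 1) = w x)
    (hW : ∀ x ∈ Set.Ioo (0 : ℝ) 1, w x = W x) (hWc : Continuous W)
    (hk : ∀ x, k (x + 1) = k x) (hK : ∀ x ∈ Set.Ioo (0 : ℝ) 1, k x = K x)
    (hKc : Continuous K) (x r : ℝ) :
    IntervalIntegrable (fun y => w (x - y) * k (y - r)) MeasureTheory.volume 0 1 ∧
      ∫ y in (0 : ℝ)..1, w (x - y) * k (y - r) =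
        (∫ z in (0 : ℝ)..Int.fract (x - r), W z * K (Int.fract (x - r) - z)) +
          ∫ z in Int.fract (x - r)..1, W z * K (Int.fract (x - r) - z + 1) := by
  set f := Int.fract (x - r) with hf
  have hfl : x - r = ⌊x - r⌋ + f := (Int.floor_add_fract _).symm
  let F : ℝ → ℝ := fun z => w z * k (x - r - z)
  have hF : Function.Periodic F 1 := fun z => by
    have h := hk (x - r - (z + 1))
    rw [show x - r - (z + 1) + 1 = x - r - z by ring] at h
    simp only [F, hw, h]
  have hf0 : 0 ≤ f := Int.fract_nonneg _
  have hf1 : f ≤ 1 := (Int.fract_lt_one _).le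
  obtain ⟨hi, hv⟩ := integral_of_piecewise (F := F) (P := fun z => W z * K (f - z))
    (Q := fun z => W z * K (f - z + 1)) hf0 hf1 (by fun_prop) (by fun_prop)
    (fun z hz => by
      simp only [F]
      rw [hW z ⟨hz.1, hz.2.trans_le hf1⟩,
        periodic_eq_of_Ioo hk hK (n := ⌊x - r⌋)
          ⟨by linarith [hz.2], by linarith [hz.1]⟩]
      congr 2; linarith)
    (fun z hz => by
      simp only [F]
      rw [hW z ⟨hf0.trans_lt hz.1, hz.2⟩,
        periodic_eq_of_Ioo hk hK (n := ⌊x - r⌋ - 1)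
          ⟨by push_cast; linarith [hz.2], by push_cast; linarith [hz.1]⟩]
      congr 2; push_cast; linarith)
  have hcomp : (fun y => w (x - y) * k (y - r)) = fun y => F (x - y) := by
    funext y
    simp only [F]
    rw [show x - r - (x - y) = y - r by ring]
  rw [hcomp]
  constructor
  · have h := (hF.intervalIntegrable₀ one_ne_zero hi x (x - 1)).comp_sub_left x
    simpa using h
  · rw [intervalIntegral.integral_comp_sub_left F x, ← hv]
    have h := hF.intervalIntegral_add_eq (x - 1) 0
    simpa using h

lemma sum_sum_eq_zero_of_antisymm {ι : Type*} [Fintype ι] {T : ι → ι → ℝ}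
    (hT : ∀ i j, T i j + T j i = 0) : ∑ i, ∑ j, T i j = 0 := by
  have h : ∑ i, ∑ j, T i j = ∑ i, ∑ j, T j i := Finset.sum_comm
  have h2 : (∑ i, ∑ j, T i j) + ∑ i, ∑ j, T j i = 0 := by
    simp only [← Finset.sum_add_distrib, hT, Finset.sum_const_zero]
  linarith

/-- The pairwise relations between the kernels at `x - q i`, `x - q j` and `q i - q j` that make
the shock-peakon system solve the equation. -/
lemma shockpeakon_identity {ι : Type*} [Fintype ι] (p s B : ι → ℝ) (G' G : ι → ι → ℝ)
    (hG' : ∀ i j, G' j i = -G' i j) (hG : ∀ i j, G j i = G i j)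
    (hBG : ∀ i j, G i j = (B j - B i) * G' i j - (B j - B i) ^ 2 / 2 + 13 / 12) :
    (∑ i, (2 * (s i * (∑ j, p j) - p i * ((∑ j, p j * G' i j) + ∑ j, s j))
          * (B i ^ 2 / 2 + 23 / 24)
        + -(s i * ((∑ j, p j * G' i j) + ∑ j, s j)) * B i
        - (∑ j, (p j * G i j + s j * G' i j)) * (p i * B i + s i)))
      + (∑ i, (p i * (B i ^ 2 / 2 + 23 / 24) + s i * B i)) * (∑ j, (p j * B j + s j))
      + 3 * (∑ j, p j) *
        ∑ i, (p i * (-(B i ^ 3 - B i / 4) / 6) + s i * (1 - (B i ^ 2 / 2 + 23 / 24))) = 0 := by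
  rw [← sum_sum_eq_zero_of_antisymm (T := fun i j =>
    2 * (s i * p j - p i * (p j * G' i j + s j)) * (B i ^ 2 / 2 + 23 / 24)
      - s i * (p j * G' i j + s j) * B i
      - (p j * G i j + s j * G' i j) * (p i * B i + s i)
      + (p i * (B i ^ 2 / 2 + 23 / 24) + s i * B i) * (p j * B j + s j)
      + 3 * p j * (p i * (-(B i ^ 3 - B i / 4) / 6) + s i * (1 - (B i ^ 2 / 2 + 23 / 24))))
    (fun i j => by
      simp only [hG' i j, hG i j, hBG i j]
      ring)]
  rw [Finset.sum_mul, Finset.mul_sum, ← Finset.sum_add_distrib, ← Finset.sum_add_distrib]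
  refine Finset.sum_congr rfl fun i _ => ?_
  simp only [Finset.sum_add_distrib, Finset.sum_sub_distrib, ← Finset.mul_sum, ← Finset.sum_mul]
  ring

lemma integral_of_eq_cubic {F : ℝ → ℝ} (c₀ c₁ c₂ c₃ : ℝ) {a b : ℝ}
    (hF : ∀ z, F z = c₀ + c₁ * z + c₂ * z ^ 2 + c₃ * z ^ 3) :
    ∫ z in a..b, F z = c₀ * (b - a) + c₁ * (b ^ 2 - a ^ 2) / 2 + c₂ * (b ^ 3 - a ^ 3) / 3
      + c₃ * (b ^ 4 - a ^ 4) / 4 := by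
  have hd : ∀ z, HasDerivAt
      (fun z => c₀ * z + c₁ * z ^ 2 / 2 + c₂ * z ^ 3 / 3 + c₃ * z ^ 4 / 4) (F z) z := fun z => by
    refine (((((hasDerivAt_id z).const_mul c₀).fun_add
      (((hasDerivAt_pow 2 z).const_mul c₁).div_const 2)).fun_add
      (((hasDerivAt_pow 3 z).const_mul c₂).div_const 3)).fun_add
      (((hasDerivAt_pow 4 z).const_mul c₃).div_const 4)).congr_deriv ?_
    rw [hF]
    norm_num
    ring
  have hc : Continuous F := by
    rw [funext hF]
    fun_prop
  rw [intervalIntegral.integral_eq_sub_of_hasDerivAt (fun z _ => hd z) (hc.intervalIntegrable a b)]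
  ring

lemma green_of_int {g : ℝ → ℝ} (hgper : ∀ x, g (x + 1) = g x)
    (hgval : ∀ x ∈ Set.Ico (0 : ℝ) 1, g x = x * (x - 1) / 2 + 13 / 12)
    (n : ℤ) : g n = 13 / 12 := by
  have hper : Function.Periodic g 1 := hgper
  have h := hper.int_mul_eq n
  rw [mul_one] at h
  rw [h, hgval 0 (by simp)]
  norm_num

lemma greenDeriv_of_int {g' : ℝ → ℝ} (hg'per : ∀ x, g' (x + 1) = g' x) (hg'0 : g' 0 = 0)
    (n : ℤ) : g' n = 0 := by
  have hper : Function.Periodic g' 1 := hg'per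
  have h := hper.int_mul_eq n
  rw [mul_one] at h
  rw [h, hg'0]

lemma green_of_mem_Ioo {g : ℝ → ℝ} (hgper : ∀ x, g (x + 1) = g x)
    (hgval : ∀ x ∈ Set.Ico (0 : ℝ) 1, g x = x * (x - 1) / 2 + 13 / 12)
    {y : ℝ} {n : ℤ} (hy : y ∈ Set.Ioo (n : ℝ) (n + 1)) :
    g y = (y - n) * (y - n - 1) / 2 + 13 / 12 :=
  periodic_eq_of_Ioo (K := fun x => x * (x - 1) / 2 + 13 / 12) hgper
    (fun x hx => hgval x ⟨hx.1.le, hx.2⟩) hy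

lemma greenDeriv_of_mem_Ioo {g' : ℝ → ℝ} (hg'per : ∀ x, g' (x + 1) = g' x)
    (hg'val : ∀ x ∈ Set.Ioo (0 : ℝ) 1, g' x = x - 1 / 2)
    {y : ℝ} {n : ℤ} (hy : y ∈ Set.Ioo (n : ℝ) (n + 1)) :
    g' y = y - n - 1 / 2 :=
  periodic_eq_of_Ioo (K := fun x => x - 1 / 2) hg'per hg'val hy

lemma green_neg {g : ℝ → ℝ} (hgper : ∀ x, g (x + 1) = g x)
    (hgval : ∀ x ∈ Set.Ico (0 : ℝ) 1, g x = x * (x - 1) / 2 + 13 / 12)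
    (y : ℝ) : g (-y) = g y := by
  by_cases hy : ∃ n : ℤ, y = n
  · obtain ⟨n, rfl⟩ := hy
    rw [← Int.cast_neg, green_of_int hgper hgval, green_of_int hgper hgval]
  · have h := mem_Ioo_floor hy
    rw [green_of_mem_Ioo hgper hgval h, green_of_mem_Ioo hgper hgval (n := -⌊y⌋ - 1)
      ⟨by push_cast; linarith [h.2], by push_cast; linarith [h.1]⟩]
    push_cast
    ring

lemma greenDeriv_neg {g' : ℝ → ℝ} (hg'per : ∀ x, g' (x + 1) = g' x) (hg'0 : g' 0 = 0)
    (hg'val : ∀ x ∈ Set.Ioo (0 : ℝ) 1, g' x = x - 1 / 2)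
    (y : ℝ) : g' (-y) = -g' y := by
  by_cases hy : ∃ n : ℤ, y = n
  · obtain ⟨n, rfl⟩ := hy
    rw [← Int.cast_neg, greenDeriv_of_int hg'per hg'0, greenDeriv_of_int hg'per hg'0, neg_zero]
  · have h := mem_Ioo_floor hy
    rw [greenDeriv_of_mem_Ioo hg'per hg'val h,
      greenDeriv_of_mem_Ioo hg'per hg'val (n := -⌊y⌋ - 1)
        ⟨by push_cast; linarith [h.2], by push_cast; linarith [h.1]⟩]
    push_cast
    ring

lemma green_eq_mul_greenDeriv {g g' : ℝ → ℝ} (hgper : ∀ x, g (x + 1) = g x)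
    (hgval : ∀ x ∈ Set.Ico (0 : ℝ) 1, g x = x * (x - 1) / 2 + 13 / 12)
    (hg'per : ∀ x, g' (x + 1) = g' x) (hg'val : ∀ x ∈ Set.Ioo (0 : ℝ) 1, g' x = x - 1 / 2)
    {y d : ℝ} {m : ℤ} (hy : y = m + d) (hd : |d| < 1) :
    g y = d * g' y - d ^ 2 / 2 + 13 / 12 := by
  obtain ⟨h1, h2⟩ := abs_lt.mp hd
  rcases lt_trichotomy d 0 with h | rfl | h
  · have hm : y ∈ Set.Ioo ((m - 1 : ℤ) : ℝ) ((m - 1 : ℤ) + 1) :=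
      ⟨by push_cast; linarith, by push_cast; linarith⟩
    rw [green_of_mem_Ioo hgper hgval hm, greenDeriv_of_mem_Ioo hg'per hg'val hm, hy]
    push_cast
    ring
  · rw [hy, add_zero, green_of_int hgper hgval]
    norm_num
  · have hm : y ∈ Set.Ioo (m : ℝ) (m + 1) := ⟨by linarith, by linarith⟩
    rw [green_of_mem_Ioo hgper hgval hm, greenDeriv_of_mem_Ioo hg'per hg'val hm, hy]
    ring

lemma green_eq_sq {g g' : ℝ → ℝ} (hgper : ∀ x, g (x + 1) = g x)
    (hgval : ∀ x ∈ Set.Ico (0 : ℝ) 1, g x = x * (x - 1) / 2 + 13 / 12)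
    (hg'per : ∀ x, g' (x + 1) = g' x) (hg'val : ∀ x ∈ Set.Ioo (0 : ℝ) 1, g' x = x - 1 / 2)
    {y : ℝ} (hy : ¬∃ n : ℤ, y = n) : g y = g' y ^ 2 / 2 + 23 / 24 := by
  have h := mem_Ioo_floor hy
  rw [green_of_mem_Ioo hgper hgval h, greenDeriv_of_mem_Ioo hg'per hg'val h]
  ring

lemma hasDerivAt_green {g g' : ℝ → ℝ} (hgper : ∀ x, g (x + 1) = g x)
    (hgval : ∀ x ∈ Set.Ico (0 : ℝ) 1, g x = x * (x - 1) / 2 + 13 / 12)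
    (hg'per : ∀ x, g' (x + 1) = g' x) (hg'val : ∀ x ∈ Set.Ioo (0 : ℝ) 1, g' x = x - 1 / 2)
    {y : ℝ} (hy : ¬∃ n : ℤ, y = n) : HasDerivAt g (g' y) y := by
  refine hasDerivAt_periodic_of_Ioo (K := fun x => x * (x - 1) / 2 + 13 / 12) hgper
    (fun x hx => hgval x ⟨hx.1.le, hx.2⟩) hy ?_
  rw [greenDeriv_of_mem_Ioo hg'per hg'val (mem_Ioo_floor hy), Int.self_sub_floor]
  refine ((((hasDerivAt_id (Int.fract y)).fun_mul
    ((hasDerivAt_id (Int.fract y)).sub_const 1)).div_const 2).add_const (13 / 12)).congr_deriv ?_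
  simp only [id]
  ring

lemma hasDerivAt_greenDeriv {g' : ℝ → ℝ} (hg'per : ∀ x, g' (x + 1) = g' x)
    (hg'val : ∀ x ∈ Set.Ioo (0 : ℝ) 1, g' x = x - 1 / 2)
    {y : ℝ} (hy : ¬∃ n : ℤ, y = n) : HasDerivAt g' 1 y :=
  hasDerivAt_periodic_of_Ioo (K := fun x => x - 1 / 2) hg'per hg'val hy
    ((hasDerivAt_id _).sub_const _)

lemma integral_green {g : ℝ → ℝ} (hgper : ∀ x, g (x + 1) = g x)
    (hgval : ∀ x ∈ Set.Ico (0 : ℝ) 1, g x = x * (x - 1) / 2 + 13 / 12)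
    (r : ℝ) :
    IntervalIntegrable (fun y => g (y - r)) MeasureTheory.volume 0 1 ∧
      ∫ y in (0 : ℝ)..1, g (y - r) = 1 := by
  obtain ⟨h1, h2⟩ := periodic_convolution (w := fun _ => 1) (W := fun _ => 1)
    (K := fun x => x * (x - 1) / 2 + 13 / 12) (fun _ => rfl) (fun _ _ => rfl) (by fun_prop)
    hgper (fun x hx => hgval x ⟨hx.1.le, hx.2⟩) (by fun_prop) r r
  simp only [one_mul] at h1 h2
  refine ⟨h1, h2.trans ?_⟩
  rw [sub_self, Int.fract_zero]
  rw [intervalIntegral.integral_same, integral_of_eq_cubic (13 / 12) (-1 / 2) (1 / 2) 0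
    (fun z => by ring)]
  norm_num

lemma integral_greenDeriv {g' : ℝ → ℝ} (hg'per : ∀ x, g' (x + 1) = g' x)
    (hg'val : ∀ x ∈ Set.Ioo (0 : ℝ) 1, g' x = x - 1 / 2)
    (r : ℝ) :
    IntervalIntegrable (fun y => g' (y - r)) MeasureTheory.volume 0 1 ∧
      ∫ y in (0 : ℝ)..1, g' (y - r) = 0 := by
  obtain ⟨h1, h2⟩ := periodic_convolution (w := fun _ => 1) (W := fun _ => 1)
    (K := fun x => x - 1 / 2) (fun _ => rfl) (fun _ _ => rfl) (by fun_prop)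
    hg'per hg'val (by fun_prop) r r
  simp only [one_mul] at h1 h2
  refine ⟨h1, h2.trans ?_⟩
  rw [sub_self, Int.fract_zero]
  rw [intervalIntegral.integral_same, integral_of_eq_cubic (1 / 2) (-1) 0 0 (fun z => by ring)]
  norm_num

lemma integral_greenDeriv_mul_green {g g' : ℝ → ℝ} (hgper : ∀ x, g (x + 1) = g x)
    (hgval : ∀ x ∈ Set.Ico (0 : ℝ) 1, g x = x * (x - 1) / 2 + 13 / 12)
    (hg'per : ∀ x, g' (x + 1) = g' x) (hg'val : ∀ x ∈ Set.Ioo (0 : ℝ) 1, g' x = x - 1 / 2)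
    {x r : ℝ} (hx : ¬∃ n : ℤ, x - r = n) :
    IntervalIntegrable (fun y => g' (x - y) * g (y - r)) MeasureTheory.volume 0 1 ∧
      ∫ y in (0 : ℝ)..1, g' (x - y) * g (y - r) =
        -(g' (x - r) ^ 3 - g' (x - r) / 4) / 6 := by
  obtain ⟨h1, h2⟩ := periodic_convolution (K := fun x => x * (x - 1) / 2 + 13 / 12)
    hg'per hg'val (by fun_prop)
    hgper (fun x hx => hgval x ⟨hx.1.le, hx.2⟩) (by fun_prop) x r
  refine ⟨h1, h2.trans ?_⟩
  rw [greenDeriv_of_mem_Ioo hg'per hg'val (mem_Ioo_floor hx), Int.self_sub_floor]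
  generalize Int.fract (x - r) = f
  rw [integral_of_eq_cubic (-((f ^ 2 - f) / 2 + 13 / 12) / 2)
      ((f ^ 2 - f) / 2 + 13 / 12 + (2 * f - 1) / 4) (-(2 * f - 1) / 2 - 1 / 4) (1 / 2)
      (fun z => by ring),
    integral_of_eq_cubic (-((f ^ 2 + f) / 2 + 13 / 12) / 2)
      ((f ^ 2 + f) / 2 + 13 / 12 + (2 * f + 1) / 4) (-(2 * f + 1) / 2 - 1 / 4) (1 / 2)
      (fun z => by ring)]
  ring

lemma integral_greenDeriv_mul_greenDeriv {g' : ℝ → ℝ} (hg'per : ∀ x, g' (x + 1) = g' x)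
    (hg'val : ∀ x ∈ Set.Ioo (0 : ℝ) 1, g' x = x - 1 / 2)
    {x r : ℝ} (hx : ¬∃ n : ℤ, x - r = n) :
    IntervalIntegrable (fun y => g' (x - y) * g' (y - r)) MeasureTheory.volume 0 1 ∧
      ∫ y in (0 : ℝ)..1, g' (x - y) * g' (y - r) =
        1 - (g' (x - r) ^ 2 / 2 + 23 / 24) := by
  obtain ⟨h1, h2⟩ := periodic_convolution hg'per hg'val (by fun_prop)
    hg'per hg'val (by fun_prop) x r
  refine ⟨h1, h2.trans ?_⟩
  rw [greenDeriv_of_mem_Ioo hg'per hg'val (mem_Ioo_floor hx), Int.self_sub_floor]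
  generalize Int.fract (x - r) = f
  rw [integral_of_eq_cubic (-(f - 1 / 2) / 2) f (-1) 0 (fun z => by ring),
    integral_of_eq_cubic (-(f + 1 / 2) / 2) (f + 1) (-1) 0 (fun z => by ring)]
  ring

/-- if the shock-peakon data `{qᵢ, pᵢ, sᵢ}` evolve by the shock-peakon
ODE system, then `u(t,x) = Σᵢ (pᵢ g(x−qᵢ) + sᵢ g'(x−qᵢ))` satisfies the nonlocal form
of the μDP equation pointwise away from the shocks. -/
theorem shockpeakon_solves_muDP
    (N : ℕ) (hN : 1 ≤ N)
    (I : Set ℝ) (hIopen : IsOpen I) (hIconv : Convex ℝ I)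
    (g g' : ℝ → ℝ)
    (hgper : ∀ x, g (x + 1) = g x)
    (hgval : ∀ x ∈ Set.Ico (0:ℝ) 1, g x = x * (x - 1) / 2 + 13 / 12)
    (hg'per : ∀ x, g' (x + 1) = g' x)
    (hg'0 : g' 0 = 0)
    (hg'val : ∀ x ∈ Set.Ioo (0:ℝ) 1, g' x = x - 1 / 2)
    (q p s : Fin N → ℝ → ℝ)
    (hq : ∀ i, ContDiffOn ℝ 1 (q i) I) (hp : ∀ i, ContDiffOn ℝ 1 (p i) I)
    (hs : ∀ i, ContDiffOn ℝ 1 (s i) I)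
    (hsep : ∀ i j, i ≠ j → ∀ t ∈ I, ¬∃ n : ℤ, q i t - q j t = n)
    (u : ℝ × ℝ → ℝ)
    (hu : ∀ t x : ℝ, u (t, x) = ∑ i, (p i t * g (x - q i t) + s i t * g' (x - q i t)))
    (hODEq : ∀ t ∈ I, ∀ i, deriv (q i) t = u (t, q i t))
    (hODEp : ∀ t ∈ I, ∀ i, deriv (p i) t =
      2 * (s i t * (∑ j, p j t)
        - p i t * ((∑ j, p j t * g' (q i t - q j t)) + ∑ j, s j t)))
    (hODEs : ∀ t ∈ I, ∀ i, deriv (s i) t =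
      -(s i t * ((∑ j, p j t * g' (q i t - q j t)) + ∑ j, s j t))) :
    ∀ t ∈ I, ∀ x : ℝ, (∀ i, ¬∃ n : ℤ, x - q i t = n) →
      DifferentiableAt ℝ u (t, x) ∧
      pdt u (t, x) + u (t, x) * pdx u (t, x)
        + 3 * (∫ y in (0:ℝ)..1, u (t, y)) * (∫ y in (0:ℝ)..1, g' (x - y) * u (t, y)) = 0 := by
  intro t ht x hx
  have hI : I ∈ nhds t := hIopen.mem_nhds ht
  have hqd : ∀ i, DifferentiableAt ℝ (q i) t := fun i =>
    ((hq i).contDiffAt hI).differentiableAt one_ne_zero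
  have hpd : ∀ i, DifferentiableAt ℝ (p i) t := fun i =>
    ((hp i).contDiffAt hI).differentiableAt one_ne_zero
  have hsd : ∀ i, DifferentiableAt ℝ (s i) t := fun i =>
    ((hs i).contDiffAt hI).differentiableAt one_ne_zero
  have hgd : ∀ i, HasDerivAt g (g' (x - q i t)) (x - q i t) := fun i =>
    hasDerivAt_green hgper hgval hg'per hg'val (hx i)
  have hg'd : ∀ i, HasDerivAt g' 1 (x - q i t) := fun i =>
    hasDerivAt_greenDeriv hg'per hg'val (hx i)
  refine ⟨?_, ?_⟩
  · have hu' : u = fun z => ∑ i, (p i z.1 * g (z.2 - q i z.1) + s i z.1 * g' (z.2 - q i z.1)) :=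
      funext fun z => hu z.1 z.2
    rw [hu']
    refine DifferentiableAt.fun_sum fun i _ => ?_
    have hfst : DifferentiableAt ℝ (Prod.fst : ℝ × ℝ → ℝ) (t, x) := differentiableAt_fst
    have harg : DifferentiableAt ℝ (fun z : ℝ × ℝ => z.2 - q i z.1) (t, x) :=
      differentiableAt_snd.sub ((hqd i).comp (t, x) hfst)
    exact (((hpd i).comp (t, x) hfst).mul ((hgd i).differentiableAt.comp (t, x) harg)).add
      (((hsd i).comp (t, x) hfst).mul ((hg'd i).differentiableAt.comp (t, x) harg))
  have hut : pdt u (t, x) = ∑ i, (deriv (p i) t * g (x - q i t) + deriv (s i) t * g' (x - q i t)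
      - deriv (q i) t * (p i t * g' (x - q i t) + s i t)) := by
    simp only [pdt, hu]
    refine HasDerivAt.deriv (HasDerivAt.fun_sum fun i _ => ?_)
    have harg : HasDerivAt (fun τ => x - q i τ) (-deriv (q i) t) t :=
      (hqd i).hasDerivAt.const_sub x
    have hgt : HasDerivAt (fun τ => g (x - q i τ)) (g' (x - q i t) * -deriv (q i) t) t :=
      (hgd i).comp t harg
    have hg't : HasDerivAt (fun τ => g' (x - q i τ)) (1 * -deriv (q i) t) t :=
      (hg'd i).comp t harg
    refine (((hpd i).hasDerivAt.fun_mul hgt).fun_add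
      ((hsd i).hasDerivAt.fun_mul hg't)).congr_deriv ?_
    ring
  have hux : pdx u (t, x) = ∑ i, (p i t * g' (x - q i t) + s i t) := by
    simp only [pdx, hu]
    refine HasDerivAt.deriv (HasDerivAt.fun_sum fun i _ => ?_)
    convert (((hgd i).comp_sub_const x (q i t)).const_mul (p i t)).fun_add
      (((hg'd i).comp_sub_const x (q i t)).const_mul (s i t)) using 1
    ring
  have hmean : ∫ y in (0 : ℝ)..1, u (t, y) = ∑ i, p i t := by
    simp only [hu]
    rw [intervalIntegral.integral_finsetSum fun i _ =>
      ((integral_green hgper hgval (q i t)).1.const_mul (p i t)).add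
        ((integral_greenDeriv hg'per hg'val (q i t)).1.const_mul (s i t))]
    refine Finset.sum_congr rfl fun i _ => ?_
    rw [intervalIntegral.integral_add ((integral_green hgper hgval (q i t)).1.const_mul (p i t))
        ((integral_greenDeriv hg'per hg'val (q i t)).1.const_mul (s i t)),
      intervalIntegral.integral_const_mul, intervalIntegral.integral_const_mul,
      (integral_green hgper hgval (q i t)).2, (integral_greenDeriv hg'per hg'val (q i t)).2]
    ring
  have hconv : ∫ y in (0 : ℝ)..1, g' (x - y) * u (t, y) =
      ∑ i, (p i t * (-(g' (x - q i t) ^ 3 - g' (x - q i t) / 4) / 6)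
        + s i t * (1 - (g' (x - q i t) ^ 2 / 2 + 23 / 24))) := by
    have hsum : ∀ y, g' (x - y) * u (t, y) = ∑ i, (p i t * (g' (x - y) * g (y - q i t))
        + s i t * (g' (x - y) * g' (y - q i t))) := fun y => by
      rw [hu, Finset.mul_sum]
      exact Finset.sum_congr rfl fun i _ => by ring
    have h1 := fun i => integral_greenDeriv_mul_green hgper hgval hg'per hg'val (hx i)
    have h2 := fun i => integral_greenDeriv_mul_greenDeriv hg'per hg'val (hx i)
    simp only [hsum]
    rw [intervalIntegral.integral_finsetSum fun i _ =>
      ((h1 i).1.const_mul (p i t)).add ((h2 i).1.const_mul (s i t))]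
    refine Finset.sum_congr rfl fun i _ => ?_
    rw [intervalIntegral.integral_add ((h1 i).1.const_mul (p i t)) ((h2 i).1.const_mul (s i t)),
      intervalIntegral.integral_const_mul, intervalIntegral.integral_const_mul, (h1 i).2, (h2 i).2]
  rw [hut, hux, hmean, hconv, hu t x]
  simp only [hODEp t ht, hODEs t ht, hODEq t ht, hu,
    fun i => green_eq_sq hgper hgval hg'per hg'val (hx i)]
  refine shockpeakon_identity (fun i => p i t) (fun i => s i t) (fun i => g' (x - q i t))
    (fun i j => g' (q i t - q j t)) (fun i j => g (q i t - q j t)) (fun i j => ?_)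
    (fun i j => ?_) (fun i j => ?_)
  · rw [← neg_sub, greenDeriv_neg hg'per hg'0 hg'val]
  · rw [← neg_sub, green_neg hgper hgval]
  · have hi := mem_Ioo_floor (hx i)
    have hj := mem_Ioo_floor (hx j)
    have hBi := greenDeriv_of_mem_Ioo hg'per hg'val hi
    have hBj := greenDeriv_of_mem_Ioo hg'per hg'val hj
    refine green_eq_mul_greenDeriv hgper hgval hg'per hg'val
      (m := ⌊x - q j t⌋ - ⌊x - q i t⌋) ?_ (abs_lt.mpr ⟨?_, ?_⟩)
    · rw [hBi, hBj]
      push_cast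
      ring
    · linarith [hi.1, hi.2, hj.1, hj.2]
    · linarith [hi.1, hi.2, hj.1, hj.2]
end
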